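/- arXiv:0905.0417 — 2 statements merged into one kernel-verified Lean document; each statement's English description precedes it below -/
import Mathlib

section
/- Let q ≥ 2 and suppose R_1, R_2 ≥ 0 are such that there exists ω ∈ [0, (q−1)/(2q)] with R_1 < 1 − h((q−1)/(2q) + ω) and R_2 < h(ω). Then (R_1, R_2) is an achievable rate pair for q-ary (2,1)-fingerprinting: for every ε > 0 there exists n_0 such that for every n ≥ n_0 there is an (n, ⌊q^{nR_1}⌋, ⌊q^{nR_2}⌋)_q two-level randomized code that is (2,1)-fingerprinting with ε-error. -/
/-- The `q`-ary entropy function `h(x) = −x log_q(x/(q−1)) − (1−x) log_q(1−x)`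
(with the convention `h(0) = 0`, which holds automatically since `Real.logb q 0 = 0`). -/
noncomputable def qEntropy (q : ℕ) (x : ℝ) : ℝ :=
  -x * Real.logb q (x / ((q : ℝ) - 1)) - (1 - x) * Real.logb q (1 - x)

/-- `y` lies in the envelope of the fingerprints `x 0, …, x (t-1)`:
every coordinate of `y` matches the corresponding coordinate of some `x i`. -/
def InEnvelope {q n t : ℕ} (x : Fin t → Fin n → Fin q) (y : Fin n → Fin q) : Prop :=
  ∀ l, ∃ i, y l = x i l

/-- An `(n,M₁,M₂)_q` two-level code: an encoder and two decoders
(`none` plays the role of the decoding-failure output `0`). -/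
structure TwoLevelCode (q n M₁ M₂ : ℕ) where
  enc : Fin M₁ × Fin M₂ → Fin n → Fin q
  dec1 : (Fin n → Fin q) → Option (Fin M₁)
  dec2 : (Fin n → Fin q) → Option (Fin M₁ × Fin M₂)

/-- An `(n,M₁,M₂)_q` two-level randomized code: a finite set of keys (indexed by
`Fin κ`), a probability distribution `π` on the keys, and a two-level code for each key. -/
structure RandCode (q n M₁ M₂ : ℕ) where
  κ : ℕ
  π : Fin κ → ℝ
  π_nonneg : ∀ k, 0 ≤ π k
  π_sum : ∑ k, π k = 1
  code : Fin κ → TwoLevelCode q n M₁ M₂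

/-- An admissible strategy for a coalition of size `t`: a conditional probability
distribution `V(y | x₁,…,x_t)` supported on the envelope of `x₁,…,x_t`. -/
def Admissible {q n t : ℕ}
    (V : (Fin t → Fin n → Fin q) → (Fin n → Fin q) → ℝ) : Prop :=
  (∀ x y, 0 ≤ V x y) ∧ (∀ x, ∑ y, V x y = 1) ∧
  (∀ x y, ¬ InEnvelope x y → V x y = 0)

open scoped Classical in
/-- The group-tracing error probability `e₁(𝒞,𝒟₁,U,V)` for the coalition
`U = {u 0, …, u (t-1)}` and strategy `V`: the probability (over the key and the
strategy) that the decoded group is not a group of a coalition member. -/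
noncomputable def e1 {q n M₁ M₂ : ℕ} (𝒞 : RandCode q n M₁ M₂) {t : ℕ}
    (u : Fin t → Fin M₁ × Fin M₂)
    (V : (Fin t → Fin n → Fin q) → (Fin n → Fin q) → ℝ) : ℝ :=
  ∑ k, 𝒞.π k *
    ∑ y ∈ Finset.univ.filter
        (fun y : Fin n → Fin q => ¬ ∃ i, (𝒞.code k).dec1 y = some (u i).1),
      V (fun i => (𝒞.code k).enc (u i)) y

open scoped Classical in
/-- The user-tracing error probability `e₂(𝒞,𝒟₂,U,V)`: the probability that the
decoded user is not a coalition member. -/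
noncomputable def e2 {q n M₁ M₂ : ℕ} (𝒞 : RandCode q n M₁ M₂) {t : ℕ}
    (u : Fin t → Fin M₁ × Fin M₂)
    (V : (Fin t → Fin n → Fin q) → (Fin n → Fin q) → ℝ) : ℝ :=
  ∑ k, 𝒞.π k *
    ∑ y ∈ Finset.univ.filter
        (fun y : Fin n → Fin q => ¬ ∃ i, (𝒞.code k).dec2 y = some (u i)),
      V (fun i => (𝒞.code k).enc (u i)) y

/-- `(t₁,t₂)`-fingerprinting with `ε`-error: (a) for every coalition of size at most `t₂`
(given as an injective tuple of users) and every admissible strategy, `e₂ ≤ ε`;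
(b) for every coalition of size at most `t₁` and every admissible strategy, `e₁ ≤ ε`. -/
def IsFingerprinting {q n M₁ M₂ : ℕ} (𝒞 : RandCode q n M₁ M₂)
    (t₁ t₂ : ℕ) (ε : ℝ) : Prop :=
  (∀ t : ℕ, 0 < t → t ≤ t₂ → ∀ u : Fin t → Fin M₁ × Fin M₂, Function.Injective u →
    ∀ V : (Fin t → Fin n → Fin q) → (Fin n → Fin q) → ℝ, Admissible V →
      e2 𝒞 u V ≤ ε) ∧
  (∀ t : ℕ, 0 < t → t ≤ t₁ → ∀ u : Fin t → Fin M₁ × Fin M₂, Function.Injective u →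
    ∀ V : (Fin t → Fin n → Fin q) → (Fin n → Fin q) → ℝ, Admissible V →
      e1 𝒞 u V ≤ ε)

open scoped Finset

/-- Averaging over translates of a single coordinate. -/
theorem card_mul_sum_le_of_sum_shift_le {I A : Type*} [Fintype I] [DecidableEq I]
    [AddCommGroup A] [Fintype A] (g : I) (F : (I → A) → ℝ) (c : ℝ)
    (h : ∀ R : I → A, ∑ s, F (R + Pi.single (M := fun _ => A) g s) ≤ c) :
    (Fintype.card A : ℝ) * ∑ R : I → A, F R ≤ Fintype.card (I → A) * c := by
  have h₁ : ∑ s : A, ∑ R, F (R + (Pi.single g s : I → A)) = Fintype.card A * ∑ R, F R := by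
    have : ∀ s : A, ∑ R, F (R + (Pi.single g s : I → A)) = ∑ R, F R := fun s =>
      Equiv.sum_comp (Equiv.addRight (Pi.single g s : I → A)) F
    simp [this]
  rw [← h₁, Finset.sum_comm]
  calc _ ≤ ∑ _R : I → A, c := Finset.sum_le_sum fun R _ => h R
    _ = _ := by simp

/-- Total mass, mean and variance of a sum of independent centred variables. -/
theorem sum_prod_moments {α : Type*} [Fintype α] (p g : α → ℝ)
    (hp : ∑ a, p a = 1) (hg : ∑ a, p a * g a = 0) (n : ℕ) :
    ∑ x : Fin n → α, ∏ l, p (x l) = 1 ∧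
    ∑ x : Fin n → α, (∏ l, p (x l)) * ∑ l, g (x l) = 0 ∧
    ∑ x : Fin n → α, (∏ l, p (x l)) * (∑ l, g (x l)) ^ 2 = n * ∑ a, p a * g a ^ 2 := by
  induction n with
  | zero => simp
  | succ n ih =>
    obtain ⟨i₀, i₁, i₂⟩ := ih
    have key : ∀ F : (Fin (n + 1) → α) → ℝ,
        ∑ x, F x = ∑ a, ∑ x : Fin n → α, F (Fin.cons a x) := fun F => by
      rw [← (Fin.consEquiv fun _ : Fin (n + 1) => α).sum_comp F, Fintype.sum_prod_type]
      rfl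
    simp only [key, Fin.prod_univ_succ, Fin.sum_univ_succ, Fin.cons_zero, Fin.cons_succ]
    refine ⟨?_, ?_, ?_⟩
    · simp [← Finset.mul_sum, i₀, hp]
    · have : ∀ a, ∑ x : Fin n → α, (p a * ∏ l, p (x l)) * (g a + ∑ l, g (x l)) = p a * g a := by
        intro a
        calc _ = p a * g a * ∑ x : Fin n → α, ∏ l, p (x l)
              + p a * ∑ x : Fin n → α, (∏ l, p (x l)) * ∑ l, g (x l) := by
              rw [Finset.mul_sum, Finset.mul_sum, ← Finset.sum_add_distrib]
              exact Finset.sum_congr rfl fun x _ => by ring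
          _ = _ := by rw [i₀, i₁]; ring
      simp [this, hg]
    · have : ∀ a, ∑ x : Fin n → α, (p a * ∏ l, p (x l)) * (g a + ∑ l, g (x l)) ^ 2
          = p a * g a ^ 2 + p a * (n * ∑ b, p b * g b ^ 2) := by
        intro a
        calc _ = p a * g a ^ 2 * ∑ x : Fin n → α, ∏ l, p (x l)
              + 2 * p a * g a * ∑ x : Fin n → α, (∏ l, p (x l)) * ∑ l, g (x l)
              + p a * ∑ x : Fin n → α, (∏ l, p (x l)) * (∑ l, g (x l)) ^ 2 := by
              rw [Finset.mul_sum, Finset.mul_sum, Finset.mul_sum, ← Finset.sum_add_distrib,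
                ← Finset.sum_add_distrib]
              exact Finset.sum_congr rfl fun x _ => by ring
          _ = _ := by rw [i₀, i₁, i₂]; ring
      simp only [this, Finset.sum_add_distrib, ← Finset.sum_mul, hp]
      push_cast
      ring

/-- The law on `Fin q` that is nonzero with probability `μ`, uniformly. -/
noncomputable def symbolLaw (q : ℕ) [NeZero q] (μ : ℝ) (a : Fin q) : ℝ :=
  if a = 0 then 1 - μ else μ / ((q : ℝ) - 1)

theorem sum_ite_zero {q : ℕ} [NeZero q] (b c : ℝ) :
    ∑ a : Fin q, (if a = 0 then b else c) = b + ((q : ℝ) - 1) * c := by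
  have : ∀ a : Fin q, (if a = 0 then b else c) = c + if a = 0 then b - c else 0 := by
    intro a; split_ifs <;> ring
  simp only [this, Finset.sum_add_distrib, Finset.sum_ite_eq', Finset.mem_univ, if_true]
  simp
  ring

theorem sum_ite_zero_eq_hammingNorm {q n : ℕ} [NeZero q] (b c : ℝ) (x : Fin n → Fin q) :
    ∑ l, (if x l = 0 then b else c) = n * b + hammingNorm x * (c - b) := by
  have : ∀ l, (if x l = 0 then b else c) = b + if x l ≠ 0 then c - b else 0 := by
    intro l; by_cases h : x l = 0 <;> simp [h]
  simp only [this, Finset.sum_add_distrib, ← Finset.sum_filter]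
  simp [hammingNorm, mul_sub]

section SymbolLaw

variable {q : ℕ}

theorem symbolLaw_nonneg [NeZero q] (hq : 2 ≤ q) {μ : ℝ} (h0 : 0 ≤ μ) (h1 : μ ≤ 1) (a : Fin q) :
    0 ≤ symbolLaw q μ a := by
  have : (2 : ℝ) ≤ q := by exact_mod_cast hq
  unfold symbolLaw
  split_ifs
  · linarith
  · exact div_nonneg h0 (by linarith)

theorem sum_symbolLaw [NeZero q] (hq : 2 ≤ q) (μ : ℝ) : ∑ a, symbolLaw q μ a = 1 := by
  have h2 : (2 : ℝ) ≤ q := by exact_mod_cast hq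
  have : (q : ℝ) - 1 ≠ 0 := by linarith
  simp only [symbolLaw]
  rw [sum_ite_zero]
  field_simp
  ring

theorem sum_prod_symbolLaw [NeZero q] (hq : 2 ≤ q) (μ : ℝ) (n : ℕ) :
    ∑ x : Fin n → Fin q, ∏ l, symbolLaw q μ (x l) = 1 :=
  (sum_prod_moments (symbolLaw q μ) 0 (sum_symbolLaw hq μ) (by simp) n).1

/-- Chebyshev's inequality for the Hamming weight. -/
theorem sum_prod_symbolLaw_deviation_le [NeZero q] (hq : 2 ≤ q) {μ : ℝ} (h0 : 0 ≤ μ) (h1 : μ ≤ 1)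
    {δ : ℝ} (hδ : 0 < δ) {n : ℕ} (hn : 0 < n) :
    ∑ x : Fin n → Fin q with δ * n < |(hammingNorm x : ℝ) - μ * n|,
      ∏ l, symbolLaw q μ (x l) ≤ 1 / (δ ^ 2 * n) := by
  have h2 : (2 : ℝ) ≤ q := by exact_mod_cast hq
  have hq1 : (q : ℝ) - 1 ≠ 0 := by linarith
  have hn' : (0 : ℝ) < n := by exact_mod_cast hn
  let g : Fin q → ℝ := fun a => if a = 0 then -μ else 1 - μ
  have hg : ∑ a, symbolLaw q μ a * g a = 0 := by
    have : ∀ a, symbolLaw q μ a * g a =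
        if a = 0 then (1 - μ) * (-μ) else μ / ((q : ℝ) - 1) * (1 - μ) := by
      intro a; simp only [symbolLaw, g]; split_ifs <;> rfl
    simp only [this]
    rw [sum_ite_zero]
    field_simp
    ring
  have hv : ∑ a, symbolLaw q μ a * g a ^ 2 = μ * (1 - μ) := by
    have : ∀ a, symbolLaw q μ a * g a ^ 2 =
        if a = 0 then (1 - μ) * (-μ) ^ 2 else μ / ((q : ℝ) - 1) * (1 - μ) ^ 2 := by
      intro a; simp only [symbolLaw, g]; split_ifs <;> rfl
    simp only [this]
    rw [sum_ite_zero]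
    field_simp
    ring
  have hvar := (sum_prod_moments (symbolLaw q μ) g (sum_symbolLaw hq μ) hg n).2.2
  have hsum : ∀ x : Fin n → Fin q, ∑ l, g (x l) = hammingNorm x - μ * n := by
    intro x
    simp only [g]
    rw [sum_ite_zero_eq_hammingNorm]
    ring
  simp only [hsum, hv] at hvar
  have hP : ∀ x : Fin n → Fin q, 0 ≤ ∏ l, symbolLaw q μ (x l) := fun x =>
    Finset.prod_nonneg fun l _ => symbolLaw_nonneg hq h0 h1 _
  have hle : (∑ x : Fin n → Fin q with δ * n < |(hammingNorm x : ℝ) - μ * n|,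
      ∏ l, symbolLaw q μ (x l)) * (δ * n) ^ 2 ≤ n * (μ * (1 - μ)) := by
    rw [← hvar, Finset.sum_mul]
    calc _ ≤ ∑ x : Fin n → Fin q with δ * n < |(hammingNorm x : ℝ) - μ * n|,
          (∏ l, symbolLaw q μ (x l)) * ((hammingNorm x : ℝ) - μ * n) ^ 2 := by
          refine Finset.sum_le_sum fun x hx => mul_le_mul_of_nonneg_left ?_ (hP x)
          rw [← sq_abs ((hammingNorm x : ℝ) - μ * n)]
          have := (Finset.mem_filter.1 hx).2
          gcongr
      _ ≤ _ := Finset.sum_le_sum_of_subset_of_nonneg (Finset.filter_subset _ _)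
          fun x _ _ => mul_nonneg (hP x) (sq_nonneg _)
  rw [le_div_iff₀ (by positivity)]
  have : μ * (1 - μ) ≤ 1 := by nlinarith
  refine le_of_mul_le_mul_right ?_ hn'
  calc _ = _ := by ring
    _ ≤ n * (μ * (1 - μ)) := hle
    _ ≤ 1 * n := by nlinarith

theorem prod_symbolLaw_eq_rpow [NeZero q] (hq : 2 ≤ q) {μ : ℝ} (h0 : 0 < μ) (h1 : μ < 1) {n : ℕ}
    (x : Fin n → Fin q) :
    ∏ l, symbolLaw q μ (x l) = (q : ℝ) ^ (-(n * qEntropy q μ) + (hammingNorm x - μ * n) *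
      (Real.logb q (μ / ((q : ℝ) - 1)) - Real.logb q (1 - μ))) := by
  have h2 : (2 : ℝ) ≤ q := by exact_mod_cast hq
  have hq1 : (0 : ℝ) < (q : ℝ) - 1 := by linarith
  have : ∀ a : Fin q, symbolLaw q μ a = (q : ℝ) ^
      (if a = 0 then Real.logb q (1 - μ) else Real.logb q (μ / ((q : ℝ) - 1))) := by
    intro a
    unfold symbolLaw
    split_ifs
    · rw [Real.rpow_logb (by linarith) (by linarith) (by linarith)]
    · rw [Real.rpow_logb (by linarith) (by linarith) (by positivity)]
  simp only [this]
  rw [← Real.rpow_sum_of_pos (by linarith), sum_ite_zero_eq_hammingNorm]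
  congr 1
  unfold qEntropy
  ring

theorem logb_slope_nonpos (hq : 2 ≤ q) {μ : ℝ} (h0 : 0 < μ) (h1 : μ ≤ ((q : ℝ) - 1) / q) :
    Real.logb q (μ / ((q : ℝ) - 1)) - Real.logb q (1 - μ) ≤ 0 := by
  have h2 : (2 : ℝ) ≤ q := by exact_mod_cast hq
  have hq1 : (0 : ℝ) < (q : ℝ) - 1 := by linarith
  rw [sub_nonpos]
  refine Real.logb_le_logb_of_le (by linarith) (by positivity) ?_
  rw [le_div_iff₀ (by linarith)] at h1
  rw [div_le_iff₀ hq1]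
  linarith

/-- Hamming ball upper bound. -/
theorem card_ball_le [NeZero q] (hq : 2 ≤ q) {ρ : ℝ} (h0 : 0 < ρ) (h1 : ρ ≤ ((q : ℝ) - 1) / q) (n : ℕ) :
    (#{x : Fin n → Fin q | (hammingNorm x : ℝ) ≤ ρ * n} : ℝ) ≤ (q : ℝ) ^ (n * qEntropy q ρ) := by
  have h2 : (2 : ℝ) ≤ q := by exact_mod_cast hq
  have hρ : ρ < 1 := h1.trans_lt (by rw [div_lt_one (by linarith)]; linarith)
  have hT := logb_slope_nonpos hq h0 h1
  have hle : (#{x : Fin n → Fin q | (hammingNorm x : ℝ) ≤ ρ * n} : ℝ)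
      * (q : ℝ) ^ (-(n * qEntropy q ρ)) ≤ 1 := by
    rw [← sum_prod_symbolLaw hq ρ n, ← nsmul_eq_mul, ← Finset.sum_const]
    calc _ ≤ ∑ x : Fin n → Fin q with (hammingNorm x : ℝ) ≤ ρ * n,
          ∏ l, symbolLaw q ρ (x l) := by
          refine Finset.sum_le_sum fun x hx => ?_
          rw [prod_symbolLaw_eq_rpow hq h0 hρ]
          refine Real.rpow_le_rpow_of_exponent_le (by linarith) ?_
          have := (Finset.mem_filter.1 hx).2
          nlinarith
      _ ≤ _ := Finset.sum_le_sum_of_subset_of_nonneg (Finset.filter_subset _ _)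
          fun x _ _ => Finset.prod_nonneg fun l _ => symbolLaw_nonneg hq h0.le hρ.le _
  rwa [Real.rpow_neg (by linarith), ← div_eq_mul_inv, div_le_one (by positivity)] at hle

/-- Few words have weight far above the average of a uniform word. -/
theorem card_heavy_le [NeZero q] (hq : 2 ≤ q) {δ : ℝ} (hδ : 0 < δ) {n : ℕ} (hn : 0 < n) :
    (#{x : Fin n → Fin q | (((q : ℝ) - 1) / q + δ) * n < hammingNorm x} : ℝ) ≤
      1 / (δ ^ 2 * n) * (q : ℝ) ^ n := by
  have h2 : (2 : ℝ) ≤ q := by exact_mod_cast hq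
  have hq1 : (0 : ℝ) < (q : ℝ) - 1 := by linarith
  have hμ0 : 0 ≤ ((q : ℝ) - 1) / q := by positivity
  have hμ1 : ((q : ℝ) - 1) / q ≤ 1 := by rw [div_le_one (by linarith)]; linarith
  have hlaw : ∀ a : Fin q, symbolLaw q (((q : ℝ) - 1) / q) a = (q : ℝ)⁻¹ := by
    intro a
    unfold symbolLaw
    split_ifs <;> field_simp
    ring
  have h := sum_prod_symbolLaw_deviation_le hq hμ0 hμ1 hδ hn
  simp only [hlaw, Finset.prod_const, Finset.sum_const, Finset.card_univ, Fintype.card_fin,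
    nsmul_eq_mul, inv_pow] at h
  rw [← div_eq_mul_inv, div_le_iff₀ (by positivity)] at h
  refine le_trans ?_ h
  refine Nat.cast_le.2 (Finset.card_le_card (Finset.monotone_filter_right _ fun x _ hx => ?_))
  exact lt_of_lt_of_le (by linarith) (le_abs_self _)

theorem continuousAt_qEntropy (hq : 2 ≤ q) {x : ℝ} (h0 : 0 < x) (h1 : x < 1) :
    ContinuousAt (qEntropy q) x := by
  have h2 : (2 : ℝ) ≤ q := by exact_mod_cast hq
  have hq1 : (0 : ℝ) < (q : ℝ) - 1 := by linarith
  unfold qEntropy Real.logb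
  have a1 : x / ((q : ℝ) - 1) ≠ 0 := by positivity
  have a2 : 1 - x ≠ 0 := by linarith
  fun_prop (disch := assumption)

theorem qEntropy_uniform (hq : 2 ≤ q) : qEntropy q (((q : ℝ) - 1) / q) = 1 := by
  have h2 : (2 : ℝ) ≤ q := by exact_mod_cast hq
  have hq1 : (0 : ℝ) < (q : ℝ) - 1 := by linarith
  have ev₁ : ((q : ℝ) - 1) / q / ((q : ℝ) - 1) = (q : ℝ)⁻¹ := by field_simp
  have ev₂ : 1 - ((q : ℝ) - 1) / q = (q : ℝ)⁻¹ := by field_simp; ring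
  rw [qEntropy, ev₁, ev₂, Real.logb_inv, Real.logb_self_eq_one (by linarith)]
  field_simp
  ring

theorem eventually_rpow_neg_le (hq : 2 ≤ q) {γ ε : ℝ} (hγ : 0 < γ) (hε : 0 < ε) :
    ∀ᶠ n : ℕ in Filter.atTop, (q : ℝ) ^ (-(n * γ)) ≤ ε := by
  have h2 : (2 : ℝ) ≤ q := by exact_mod_cast hq
  have hb : (q : ℝ) ^ (-γ) < 1 := Real.rpow_lt_one_of_one_lt_of_neg (by linarith) (by linarith)
  have := tendsto_pow_atTop_nhds_zero_of_lt_one (by positivity : (0 : ℝ) ≤ (q : ℝ) ^ (-γ)) hb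
  filter_upwards [this.eventually_le_const hε] with n hn
  rwa [← Real.rpow_natCast, ← Real.rpow_mul (by linarith),
    show -γ * (n : ℝ) = -(n * γ) by ring] at hn

theorem eventually_one_div_le (c : ℝ) {ε : ℝ} (hε : 0 < ε) :
    ∀ᶠ n : ℕ in Filter.atTop, 1 / (c * n) ≤ ε := by
  have := tendsto_const_div_atTop_nhds_zero_nat (1 / c)
  filter_upwards [this.eventually_le_const hε] with n hn
  rwa [div_div] at hn

/-- Hamming ball lower bound. -/
theorem eventually_rpow_le_card_ball [NeZero q] (hq : 2 ≤ q) {ω R : ℝ} (h0 : 0 < ω)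
    (h1 : ω ≤ ((q : ℝ) - 1) / q) (hR : R < qEntropy q ω) :
    ∀ᶠ n : ℕ in Filter.atTop,
      (q : ℝ) ^ (n * R) ≤ #{x : Fin n → Fin q | (hammingNorm x : ℝ) ≤ ω * n} := by
  have h2 : (2 : ℝ) ≤ q := by exact_mod_cast hq
  have hω : ω < 1 := h1.trans_lt (by rw [div_lt_one (by linarith)]; linarith)
  obtain ⟨μ, hμR, hμ0, hμω⟩ : ∃ μ, R < qEntropy q μ ∧ 0 < μ ∧ μ < ω := by
    have ev₁ := ((continuousAt_qEntropy hq h0 hω).eventually_const_lt hR).filter_mono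
      (nhdsWithin_le_nhds (s := Set.Iio ω))
    have ev₂ : ∀ᶠ μ in nhdsWithin ω (Set.Iio ω), μ ∈ Set.Ioo 0 ω := Ioo_mem_nhdsLT h0
    obtain ⟨μ, a, b⟩ := (ev₁.and ev₂).exists
    exact ⟨μ, a, b⟩
  set T := Real.logb q (μ / ((q : ℝ) - 1)) - Real.logb q (1 - μ) with hTdef
  have hT : T ≤ 0 := logb_slope_nonpos hq hμ0 (hμω.le.trans h1)
  have hT' : 0 < 1 - T := by linarith
  set γ := (qEntropy q μ - R) / 2 with hγdef
  have hγ : 0 < γ := by linarith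
  set δ := min (ω - μ) (γ / (1 - T)) with hδdef
  have hδ : 0 < δ := lt_min (by linarith) (by positivity)
  have hδT : δ * (-T) ≤ γ := by
    have := (le_div_iff₀ hT').1 (min_le_right (ω - μ) (γ / (1 - T)))
    rw [← hδdef] at this
    nlinarith
  filter_upwards [eventually_one_div_le (δ ^ 2) (half_pos one_pos),
    eventually_rpow_neg_le hq hγ (half_pos one_pos), Filter.eventually_gt_atTop 0] with n c1 c2 hn
  have hn' : (0 : ℝ) < n := by exact_mod_cast hn
  have cheb := (sum_prod_symbolLaw_deviation_le hq hμ0.le (hμω.trans hω).le hδ hn).trans c1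
  have tot := Finset.sum_filter_add_sum_filter_not Finset.univ
    (fun x : Fin n → Fin q => δ * n < |(hammingNorm x : ℝ) - μ * n|)
    (fun x => ∏ l, symbolLaw q μ (x l))
  rw [sum_prod_symbolLaw hq] at tot
  have low : ∑ x : Fin n → Fin q with ¬ δ * n < |(hammingNorm x : ℝ) - μ * n|,
      ∏ l, symbolLaw q μ (x l) ≤
      #{x : Fin n → Fin q | (hammingNorm x : ℝ) ≤ ω * n} * (q : ℝ) ^ (-(n * (R + γ))) := by
    rw [← nsmul_eq_mul, ← Finset.sum_const]
    calc _ ≤ ∑ x : Fin n → Fin q with ¬ δ * n < |(hammingNorm x : ℝ) - μ * n|,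
          (q : ℝ) ^ (-(n * (R + γ))) := by
          refine Finset.sum_le_sum fun x hx => ?_
          have hx := abs_le.1 (not_lt.1 (Finset.mem_filter.1 hx).2)
          rw [prod_symbolLaw_eq_rpow hq hμ0 (hμω.trans hω)]
          refine Real.rpow_le_rpow_of_exponent_le (by linarith) ?_
          rw [← hTdef]
          have ev₁ : ((hammingNorm x : ℝ) - μ * n) * T ≤ n * γ := by
            calc _ ≤ (-(δ * n)) * T := mul_le_mul_of_nonpos_right hx.1 hT
              _ = n * (δ * (-T)) := by ring
              _ ≤ _ := by gcongr
          have ev₂ : qEntropy q μ = R + 2 * γ := by rw [hγdef]; ring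
          rw [ev₂]
          linarith
      _ ≤ _ := by
          refine Finset.sum_le_sum_of_subset_of_nonneg ?_ fun _ _ _ => by positivity
          intro x hx
          have hx := abs_le.1 (not_lt.1 (Finset.mem_filter.1 hx).2)
          refine Finset.mem_filter.2 ⟨Finset.mem_univ _, ?_⟩
          have : δ * n ≤ (ω - μ) * n := by gcongr; exact min_le_left _ _
          linarith
  have half : (1 : ℝ) / 2 ≤ #{x : Fin n → Fin q | (hammingNorm x : ℝ) ≤ ω * n} *
      (q : ℝ) ^ (-(n * (R + γ))) := by linarith
  have hsplit : (q : ℝ) ^ (-(n * (R + γ))) = (q : ℝ) ^ (-(n * γ)) / (q : ℝ) ^ (n * R) := by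
    rw [← Real.rpow_sub (by linarith)]
    congr 1
    ring
  rw [hsplit, ← mul_div_assoc, le_div_iff₀ (by positivity)] at half
  have : (#{x : Fin n → Fin q | (hammingNorm x : ℝ) ≤ ω * n} : ℝ) * (q : ℝ) ^ (-(n * γ)) ≤
      #{x : Fin n → Fin q | (hammingNorm x : ℝ) ≤ ω * n} * (1 / 2) := by gcongr
  linarith

end SymbolLaw

/-- A word in the envelope of two words is within half of their distance from one of them. -/
theorem InEnvelope.exists_hammingDist_le {q n : ℕ} {x : Fin 2 → Fin n → Fin q} {y : Fin n → Fin q}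
    (h : InEnvelope x y) :
    ∃ i, 2 * hammingDist y (x i) ≤ hammingDist (x 0) (x 1) := by
  have hsum : hammingDist y (x 0) + hammingDist y (x 1) ≤ hammingDist (x 0) (x 1) := by
    simp only [hammingDist]
    rw [← Finset.card_union_of_disjoint]
    · refine Finset.card_le_card fun l hl => ?_
      simp only [Finset.mem_union, Finset.mem_filter, Finset.mem_univ, true_and] at hl ⊢
      obtain ⟨i, hi⟩ := h l
      fin_cases i <;> simp_all
      exact fun h => hl h.symm
    · rw [Finset.disjoint_left]
      intro l h0 h1
      obtain ⟨i, hi⟩ := h l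
      fin_cases i <;> simp_all
  by_cases h0 : 2 * hammingDist y (x 0) ≤ hammingDist (x 0) (x 1)
  · exact ⟨0, h0⟩
  · exact ⟨1, by omega⟩

section ShiftCode

variable {q n M₁ M₂ : ℕ} [NeZero q]

open scoped Classical in
/-- Group `g` has centre `R g`, and user `(g, j)` has fingerprint `R g + z j`. Groups are decoded
to a centre within distance `r`, users are decoded to a matching fingerprint. -/
noncomputable def shiftCode (z : Fin M₂ → Fin n → Fin q) (r : ℝ) (R : Fin M₁ → Fin n → Fin q) :
    TwoLevelCode q n M₁ M₂ where
  enc u := R u.1 + z u.2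
  dec1 y := if h : ∃ g, (hammingDist y (R g) : ℝ) ≤ r then some h.choose else none
  dec2 y := if h : ∃ u : Fin M₁ × Fin M₂, R u.1 + z u.2 = y then some h.choose else none

/-- The randomized code `shiftCode` with independent uniform centres. -/
noncomputable def randomShiftCode (M₁ : ℕ) (z : Fin M₂ → Fin n → Fin q) (r : ℝ) :
    RandCode q n M₁ M₂ where
  κ := Fintype.card (Fin M₁ → Fin n → Fin q)
  π _ := (Fintype.card (Fin M₁ → Fin n → Fin q) : ℝ)⁻¹
  π_nonneg _ := by positivity
  π_sum := by
    rw [Finset.sum_const, Finset.card_univ, Fintype.card_fin, nsmul_eq_mul]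
    exact mul_inv_cancel₀ (Nat.cast_ne_zero.2 Fintype.card_ne_zero)
  code k := shiftCode z r ((Fintype.equivFin _).symm k)

/-- A coalition's output falls near the centre of an uninvolved group with small probability. -/
theorem sum_near_centre_le {t : ℕ} (z : Fin M₂ → Fin n → Fin q) (r : ℝ)
    (u : Fin t → Fin M₁ × Fin M₂) {V : (Fin t → Fin n → Fin q) → (Fin n → Fin q) → ℝ}
    (hV : Admissible V) (g : Fin M₁) (hg : ∀ i, (u i).1 ≠ g) :
    (q : ℝ) ^ n * ∑ R : Fin M₁ → Fin n → Fin q, ∑ y with (hammingDist y (R g) : ℝ) ≤ r,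
      V (fun i => R (u i).1 + z (u i).2) y ≤
    Fintype.card (Fin M₁ → Fin n → Fin q) *
      #{x : Fin n → Fin q | (hammingNorm x : ℝ) ≤ r} := by
  have h := card_mul_sum_le_of_sum_shift_le g
    (fun R : Fin M₁ → Fin n → Fin q => ∑ y with (hammingDist y (R g) : ℝ) ≤ r,
      V (fun i => R (u i).1 + z (u i).2) y)
    (#{x : Fin n → Fin q | (hammingNorm x : ℝ) ≤ r}) ?_
  · simpa using h
  intro R
  have hshift : ∀ (s : Fin n → Fin q) i, (R + Pi.single g s : Fin M₁ → Fin n → Fin q) (u i).1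
      = R (u i).1 := fun s i => by simp [hg i]
  simp only [hshift, Finset.sum_filter]
  rw [Finset.sum_comm]
  have hball : ∀ y : Fin n → Fin q,
      ∑ s : Fin n → Fin q, (if (hammingDist y ((R + Pi.single g s : Fin M₁ → Fin n → Fin q) g) : ℝ)
        ≤ r then V (fun i => R (u i).1 + z (u i).2) y else 0) =
      V (fun i => R (u i).1 + z (u i).2) y * #{x : Fin n → Fin q | (hammingNorm x : ℝ) ≤ r} := by
    intro y
    rw [← Equiv.sum_comp (Equiv.addRight (y - R g))]
    have : ∀ s : Fin n → Fin q, hammingDist y ((R + Pi.single g ((Equiv.addRight (y - R g)) s) :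
        Fin M₁ → Fin n → Fin q) g) = hammingNorm s := by
      intro s
      rw [hammingDist_eq_hammingNorm]
      congr 1
      simp
      abel
    simp only [this]
    rw [← Finset.sum_filter, Finset.sum_const, nsmul_eq_mul, mul_comm]
  simp only [hball]
  rw [← Finset.sum_mul, hV.2.1, one_mul]

/-- Fingerprints from different groups are rarely far apart. -/
theorem card_far_le (z : Fin M₂ → Fin n → Fin q) (τ : ℝ) (u v : Fin M₁ × Fin M₂)
    (huv : u.1 ≠ v.1) :
    (q : ℝ) ^ n * #{R : Fin M₁ → Fin n → Fin q |
      τ < hammingDist (R u.1 + z u.2) (R v.1 + z v.2)} ≤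
    Fintype.card (Fin M₁ → Fin n → Fin q) * #{x : Fin n → Fin q | τ < hammingNorm x} := by
  have h := card_mul_sum_le_of_sum_shift_le u.1
    (fun R : Fin M₁ → Fin n → Fin q =>
      if τ < hammingDist (R u.1 + z u.2) (R v.1 + z v.2) then 1 else 0)
    (#{x : Fin n → Fin q | τ < hammingNorm x}) ?_
  · rw [← Finset.sum_filter] at h
    simpa using h
  intro R
  rw [← Equiv.sum_comp (Equiv.subLeft (R v.1 + z v.2 - (R u.1 + z u.2)))]
  have : ∀ s : Fin n → Fin q, hammingDist
      ((R + Pi.single u.1 ((Equiv.subLeft (R v.1 + z v.2 - (R u.1 + z u.2))) s) :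
        Fin M₁ → Fin n → Fin q) u.1 + z u.2)
      ((R + Pi.single u.1 ((Equiv.subLeft (R v.1 + z v.2 - (R u.1 + z u.2))) s) :
        Fin M₁ → Fin n → Fin q) v.1 + z v.2) = hammingNorm s := by
    intro s
    rw [hammingDist_eq_hammingNorm]
    congr 1
    simp [huv.symm]
    abel
  simp only [this]
  rw [← Finset.sum_filter]
  simp

open scoped Classical in
/-- Union bound over an exceptional set of keys and over the uninvolved groups. -/
theorem randomShiftCode_error_le {t : ℕ} (z : Fin M₂ → Fin n → Fin q) (r : ℝ)
    (u : Fin t → Fin M₁ × Fin M₂) {V : (Fin t → Fin n → Fin q) → (Fin n → Fin q) → ℝ}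
    (hV : Admissible V) (Err : TwoLevelCode q n M₁ M₂ → (Fin n → Fin q) → Prop)
    (B : (Fin M₁ → Fin n → Fin q) → Prop) {β : ℝ}
    (hB : (#{R | B R} : ℝ) ≤ Fintype.card (Fin M₁ → Fin n → Fin q) * β)
    (hErr : ∀ R y, InEnvelope (fun i => R (u i).1 + z (u i).2) y → Err (shiftCode z r R) y →
      B R ∨ ∃ g, (∀ i, (u i).1 ≠ g) ∧ (hammingDist y (R g) : ℝ) ≤ r) :
    ∑ k, (randomShiftCode M₁ z r).π k *
      ∑ y ∈ Finset.univ.filter (fun y => Err ((randomShiftCode M₁ z r).code k) y),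
        V (fun i => ((randomShiftCode M₁ z r).code k).enc (u i)) y ≤
    β + M₁ * (#{x : Fin n → Fin q | (hammingNorm x : ℝ) ≤ r} / (q : ℝ) ^ n) := by
  set N : ℝ := ((Fintype.card (Fin M₁ → Fin n → Fin q) : ℕ) : ℝ)
  have hNpos : 0 < N := Nat.cast_pos.2 Fintype.card_pos
  have hqn : (0 : ℝ) < (q : ℝ) ^ n := by
    have : (0 : ℝ) < q := Nat.cast_pos.2 (NeZero.pos q)
    positivity
  have hkeys : ∑ k, (randomShiftCode M₁ z r).π k *
      ∑ y ∈ Finset.univ.filter (fun y => Err ((randomShiftCode M₁ z r).code k) y),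
        V (fun i => ((randomShiftCode M₁ z r).code k).enc (u i)) y =
      N⁻¹ * ∑ R : Fin M₁ → Fin n → Fin q,
        ∑ y ∈ Finset.univ.filter (fun y => Err (shiftCode z r R) y),
          V (fun i => R (u i).1 + z (u i).2) y := by
    rw [Finset.mul_sum]
    exact (Fintype.equivFin (Fin M₁ → Fin n → Fin q)).symm.sum_comp
      (fun R => N⁻¹ * ∑ y ∈ Finset.univ.filter (fun y => Err (shiftCode z r R) y),
        V (fun i => R (u i).1 + z (u i).2) y)
  have hpt : ∀ R : Fin M₁ → Fin n → Fin q,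
      ∑ y ∈ Finset.univ.filter (fun y => Err (shiftCode z r R) y),
        V (fun i => R (u i).1 + z (u i).2) y ≤
      (if B R then 1 else 0) + ∑ g with ∀ i, (u i).1 ≠ g,
        ∑ y with (hammingDist y (R g) : ℝ) ≤ r, V (fun i => R (u i).1 + z (u i).2) y := by
    intro R
    by_cases hBR : B R
    · rw [if_pos hBR]
      have h1 : ∑ y ∈ Finset.univ.filter (fun y => Err (shiftCode z r R) y),
          V (fun i => R (u i).1 + z (u i).2) y ≤ 1 := by
        rw [← hV.2.1 (fun i => R (u i).1 + z (u i).2)]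
        exact Finset.sum_le_sum_of_subset_of_nonneg (Finset.filter_subset _ _)
          fun y _ _ => hV.1 _ y
      have h2 : 0 ≤ ∑ g with ∀ i, (u i).1 ≠ g,
          ∑ y with (hammingDist y (R g) : ℝ) ≤ r, V (fun i => R (u i).1 + z (u i).2) y :=
        Finset.sum_nonneg fun g _ => Finset.sum_nonneg fun y _ => hV.1 _ y
      linarith
    · rw [if_neg hBR, zero_add]
      simp only [Finset.sum_filter (fun y : Fin n → Fin q => (hammingDist y _ : ℝ) ≤ r)]
      rw [Finset.sum_comm, Finset.sum_filter]
      refine Finset.sum_le_sum fun y _ => ?_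
      have hnn : ∀ g ∈ (Finset.univ.filter fun g => ∀ i, (u i).1 ≠ g),
          0 ≤ if (hammingDist y (R g) : ℝ) ≤ r then V (fun i => R (u i).1 + z (u i).2) y else 0 :=
        fun g _ => by split_ifs; exacts [hV.1 _ y, le_rfl]
      split_ifs with hE
      · by_cases henv : InEnvelope (fun i => R (u i).1 + z (u i).2) y
        · obtain h | ⟨g, hg, hd⟩ := hErr R y henv hE
          · exact absurd h hBR
          · refine le_trans ?_ (Finset.single_le_sum hnn
              (Finset.mem_filter.2 ⟨Finset.mem_univ g, hg⟩))
            rw [if_pos hd]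
        · rw [hV.2.2 _ _ henv]
          exact Finset.sum_nonneg (by simp)
      · exact Finset.sum_nonneg hnn
  have hgroups : ∑ R : Fin M₁ → Fin n → Fin q, ∑ g with ∀ i, (u i).1 ≠ g,
      ∑ y with (hammingDist y (R g) : ℝ) ≤ r, V (fun i => R (u i).1 + z (u i).2) y ≤
      M₁ * (N * (#{x : Fin n → Fin q | (hammingNorm x : ℝ) ≤ r} / (q : ℝ) ^ n)) := by
    rw [Finset.sum_comm]
    calc _ ≤ ∑ g : Fin M₁ with ∀ i, (u i).1 ≠ g,
          N * (#{x : Fin n → Fin q | (hammingNorm x : ℝ) ≤ r} / (q : ℝ) ^ n) := by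
          refine Finset.sum_le_sum fun g hg => ?_
          rw [← mul_div_assoc, le_div_iff₀' hqn]
          exact sum_near_centre_le z r u hV g (Finset.mem_filter.1 hg).2
      _ ≤ _ := by
          rw [Finset.sum_const, nsmul_eq_mul]
          gcongr
          exact (Finset.card_filter_le _ _).trans (by simp)
  rw [hkeys, inv_mul_le_iff₀ hNpos]
  calc _ ≤ _ := Finset.sum_le_sum fun R _ => hpt R
    _ ≤ N * β + M₁ * (N * (#{x : Fin n → Fin q | (hammingNorm x : ℝ) ≤ r} / (q : ℝ) ^ n)) := by
        rw [Finset.sum_add_distrib]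
        refine add_le_add ?_ hgroups
        simpa using hB
    _ = _ := by ring

theorem e2_randomShiftCode_le {z : Fin M₂ → Fin n → Fin q} (hz : Function.Injective z) {r : ℝ}
    (hr : ∀ j, (hammingNorm (z j) : ℝ) ≤ r) (u : Fin 1 → Fin M₁ × Fin M₂)
    {V : (Fin 1 → Fin n → Fin q) → (Fin n → Fin q) → ℝ} (hV : Admissible V) :
    e2 (randomShiftCode M₁ z r) u V ≤
      M₁ * (#{x : Fin n → Fin q | (hammingNorm x : ℝ) ≤ r} / (q : ℝ) ^ n) := by
  rw [← zero_add ((M₁ : ℝ) * _)]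
  refine le_trans (le_of_eq (by unfold e2; congr!)) (randomShiftCode_error_le z r u hV
    (fun C y => ¬ ∃ i, C.dec2 y = some (u i)) (fun _ => False) (by simp) fun R y hy hE => ?_)
  have hy' : R (u 0).1 + z (u 0).2 = y := by
    funext l
    obtain ⟨i, hi⟩ := hy l
    rw [Subsingleton.elim i 0] at hi
    exact hi.symm
  have hex : ∃ v : Fin M₁ × Fin M₂, R v.1 + z v.2 = y := ⟨u 0, hy'⟩
  obtain ⟨v, hdec, hv⟩ : ∃ v, (shiftCode z r R).dec2 y = some v ∧ R v.1 + z v.2 = y :=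
    ⟨hex.choose, dif_pos hex, hex.choose_spec⟩
  refine Or.inr ⟨v.1, fun i hi => hE ⟨i, ?_⟩, ?_⟩
  · rw [Subsingleton.elim i 0] at hi ⊢
    rw [hdec]
    congr 1
    refine Prod.ext hi.symm (hz ?_)
    rw [← hi, ← hy'] at hv
    exact add_left_cancel hv
  · rw [hammingDist_comm, hammingDist_eq_hammingNorm, ← hv, neg_add_cancel_left]
    exact hr _

open scoped Classical in
theorem e1_randomShiftCode_le {t : ℕ} (z : Fin M₂ → Fin n → Fin q) (r : ℝ)
    (u : Fin t → Fin M₁ × Fin M₂) {V : (Fin t → Fin n → Fin q) → (Fin n → Fin q) → ℝ}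
    (hV : Admissible V) (B : (Fin M₁ → Fin n → Fin q) → Prop) {β : ℝ}
    (hB : (#{R | B R} : ℝ) ≤ Fintype.card (Fin M₁ → Fin n → Fin q) * β)
    (hnear : ∀ R y, InEnvelope (fun i => R (u i).1 + z (u i).2) y → ¬ B R →
      ∃ g, (hammingDist y (R g) : ℝ) ≤ r) :
    e1 (randomShiftCode M₁ z r) u V ≤
      β + M₁ * (#{x : Fin n → Fin q | (hammingNorm x : ℝ) ≤ r} / (q : ℝ) ^ n) := by
  refine le_trans (le_of_eq (by unfold e1; congr!)) (randomShiftCode_error_le z r u hV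
    (fun C y => ¬ ∃ i, C.dec1 y = some (u i).1) B hB fun R y hy hE => ?_)
  by_cases hBR : B R
  · exact Or.inl hBR
  have hex := hnear R y hy hBR
  have hdec : (shiftCode z r R).dec1 y = some hex.choose := dif_pos hex
  exact Or.inr ⟨hex.choose, fun i hi => hE ⟨i, by rw [hdec, hi]⟩, hex.choose_spec⟩

theorem randomShiftCode_isFingerprinting {z : Fin M₂ → Fin n → Fin q} (hz : Function.Injective z)
    {w τ r ε : ℝ} (hw : ∀ j, (hammingNorm (z j) : ℝ) ≤ w) (hτ : τ / 2 + w ≤ r)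
    (hwr : 2 * w ≤ r) (hw0 : 0 ≤ w) (hε : 0 < ε)
    (hfar : (#{x : Fin n → Fin q | τ < hammingNorm x} : ℝ) ≤ ε / 2 * (q : ℝ) ^ n)
    (hball : (M₁ : ℝ) * (#{x : Fin n → Fin q | (hammingNorm x : ℝ) ≤ r} / (q : ℝ) ^ n) ≤ ε / 2) :
    IsFingerprinting (randomShiftCode M₁ z r) 2 1 ε := by
  have hqn : (0 : ℝ) < (q : ℝ) ^ n := by
    have : (0 : ℝ) < q := Nat.cast_pos.2 (NeZero.pos q)
    positivity
  have hcentre : ∀ (R : Fin M₁ → Fin n → Fin q) (v : Fin M₁ × Fin M₂) (y : Fin n → Fin q),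
      (hammingDist y (R v.1) : ℝ) ≤ hammingDist y (R v.1 + z v.2) + w := by
    intro R v y
    have h1 : hammingDist (R v.1 + z v.2) (R v.1) = hammingNorm (z v.2) := by
      rw [hammingDist_comm, hammingDist_eq_hammingNorm, neg_add_cancel_left]
    have h2 := hammingDist_triangle y (R v.1 + z v.2) (R v.1)
    rw [h1] at h2
    have h3 : (hammingDist y (R v.1) : ℝ) ≤
      hammingDist y (R v.1 + z v.2) + hammingNorm (z v.2) := by exact_mod_cast h2
    linarith [hw v.2]
  constructor
  · intro t ht0 ht u _ V hV
    obtain rfl : t = 1 := by omega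
    exact (e2_randomShiftCode_le hz (fun j => (hw j).trans (by linarith)) u hV).trans
      (by linarith)
  · intro t ht0 ht u hu V hV
    obtain rfl | rfl : t = 1 ∨ t = 2 := by omega
    · refine (e1_randomShiftCode_le z r u hV (fun _ => False) (β := 0) (by simp)
        fun R y hy _ => ⟨(u 0).1, ?_⟩).trans (by linarith)
      have hy' : R (u 0).1 + z (u 0).2 = y := by
        funext l
        obtain ⟨i, hi⟩ := hy l
        rw [Subsingleton.elim i 0] at hi
        exact hi.symm
      have := hcentre R (u 0) y
      rw [hy', hammingDist_self] at this
      push_cast at this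
      linarith
    · by_cases hG : (u 0).1 = (u 1).1
      · refine (e1_randomShiftCode_le z r u hV (fun _ => False) (β := 0) (by simp)
          fun R y hy _ => ?_).trans (by linarith)
        obtain ⟨i, hi⟩ := hy.exists_hammingDist_le
        refine ⟨(u i).1, (hcentre R (u i) y).trans ?_⟩
        have hd : hammingDist (R (u 0).1 + z (u 0).2) (R (u 1).1 + z (u 1).2) ≤
            hammingNorm (z (u 0).2) + hammingNorm (z (u 1).2) := by
          rw [hG]
          refine (hammingDist_triangle _ (R (u 1).1) _).trans (le_of_eq ?_)
          rw [hammingDist_comm _ (R (u 1).1), hammingDist_eq_hammingNorm,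
            hammingDist_eq_hammingNorm, neg_add_cancel_left, neg_add_cancel_left]
        have h3 : (2 : ℝ) * hammingDist y (R (u i).1 + z (u i).2) ≤
            hammingNorm (z (u 0).2) + hammingNorm (z (u 1).2) := by exact_mod_cast hi.trans hd
        linarith [hw (u 0).2, hw (u 1).2]
      · classical
        refine (e1_randomShiftCode_le z r u hV
          (fun R => τ < hammingDist (R (u 0).1 + z (u 0).2) (R (u 1).1 + z (u 1).2))
          (β := ε / 2) ?_ fun R y hy hR => ?_).trans (by linarith)
        · have h := card_far_le z τ (u 0) (u 1) hG
          refine le_of_mul_le_mul_left ?_ hqn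
          refine le_trans (le_of_eq ?_) (h.trans ?_)
          · congr!
          · calc _ ≤ (Fintype.card (Fin M₁ → Fin n → Fin q) : ℝ) * (ε / 2 * (q : ℝ) ^ n) := by
                  gcongr
              _ = _ := by ring
        · obtain ⟨i, hi⟩ := hy.exists_hammingDist_le
          refine ⟨(u i).1, (hcentre R (u i) y).trans ?_⟩
          have h3 : (2 : ℝ) * hammingDist y (R (u i).1 + z (u i).2) ≤
            hammingDist (R (u 0).1 + z (u 0).2) (R (u 1).1 + z (u 1).2) := by exact_mod_cast hi
          have h4 := not_lt.1 hR
          linarith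

end ShiftCode

/-- Theorem 1 of the paper: if `ω ∈ [0,(q−1)/2q]`,
`R₁ < 1 − h((q−1)/2q + ω)` and `R₂ < h(ω)`, then `(R₁,R₂)` is achievable for `q`-ary
`(2,1)`-fingerprinting: for every `ε > 0` and all large enough `n`, there is an
`(n, ⌊q^{nR₁}⌋, ⌊q^{nR₂}⌋)_q` randomized code that is `(2,1)`-fingerprinting with
`ε`-error. -/
theorem stmt14 (q : ℕ) (hq : 2 ≤ q) (R₁ R₂ : ℝ) (hR₁ : 0 ≤ R₁) (hR₂ : 0 ≤ R₂)
    (ω : ℝ) (hω0 : 0 ≤ ω) (hω1 : ω ≤ ((q : ℝ) - 1) / (2 * q))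
    (h1 : R₁ < 1 - qEntropy q (((q : ℝ) - 1) / (2 * q) + ω))
    (h2 : R₂ < qEntropy q ω) :
    ∀ ε : ℝ, 0 < ε → ∃ n₀ : ℕ, ∀ n : ℕ, n₀ ≤ n →
      ∃ 𝒞 : RandCode q n ⌊(q : ℝ) ^ ((n : ℝ) * R₁)⌋₊ ⌊(q : ℝ) ^ ((n : ℝ) * R₂)⌋₊,
        IsFingerprinting 𝒞 2 1 ε := by
  have hq2 : (2 : ℝ) ≤ q := by exact_mod_cast hq
  have : NeZero q := ⟨by omega⟩
  have hq1 : (0 : ℝ) < (q : ℝ) - 1 := by linarith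
  have hω : 0 < ω := by
    refine lt_of_le_of_ne hω0 fun h => ?_
    rw [← h] at h2
    simp [qEntropy] at h2
    linarith
  set a : ℝ := ((q : ℝ) - 1) / (2 * q) with ha
  have ha0 : 0 < a := by positivity
  have h2a : ((q : ℝ) - 1) / q = 2 * a := by rw [ha]; field_simp
  have h2a1 : 2 * a < 1 := by rw [← h2a, div_lt_one (by linarith)]; linarith
  have hlt : a + ω < 2 * a := by
    refine lt_of_le_of_ne (by linarith) fun h => ?_
    rw [h, ← h2a, qEntropy_uniform hq] at h1
    linarith
  obtain ⟨ρ, hρ1, hρlow, hρhigh⟩ : ∃ ρ, R₁ < 1 - qEntropy q ρ ∧ a + ω < ρ ∧ ρ < 2 * a := by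
    have hc := (continuousAt_qEntropy hq (by linarith : 0 < a + ω) (by linarith)).eventually_lt_const
      (show qEntropy q (a + ω) < 1 - R₁ by linarith)
    have ev₁ := hc.filter_mono (nhdsWithin_le_nhds (s := Set.Ioi (a + ω)))
    have ev₂ : ∀ᶠ ρ in nhdsWithin (a + ω) (Set.Ioi (a + ω)), ρ ∈ Set.Ioo (a + ω) (2 * a) :=
      Ioo_mem_nhdsGT hlt
    obtain ⟨ρ, h, h'⟩ := (ev₁.and ev₂).exists
    exact ⟨ρ, by linarith, h'⟩
  set δ := 2 * (ρ - (a + ω)) with hδ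
  have hδ0 : 0 < δ := by linarith
  intro ε hε
  obtain ⟨n₀, hn₀⟩ := Filter.eventually_atTop.1 ((Filter.eventually_gt_atTop 0).and
    ((eventually_rpow_le_card_ball hq hω (by linarith) h2).and
    ((eventually_one_div_le (δ ^ 2) (half_pos hε)).and
    (eventually_rpow_neg_le hq (by linarith : 0 < 1 - qEntropy q ρ - R₁) (half_pos hε)))))
  refine ⟨n₀, fun n hn => ?_⟩
  obtain ⟨hn0, hballω, hcheb, hexp⟩ := hn₀ n hn
  have hM₂ : ⌊(q : ℝ) ^ ((n : ℝ) * R₂)⌋₊ ≤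
      Fintype.card {x : Fin n → Fin q // (hammingNorm x : ℝ) ≤ ω * n} := by
    rw [Fintype.card_subtype]
    exact Nat.floor_le_of_le hballω
  obtain ⟨z⟩ := Function.Embedding.nonempty_of_card_le
    (α := Fin ⌊(q : ℝ) ^ ((n : ℝ) * R₂)⌋₊)
    (β := {x : Fin n → Fin q // (hammingNorm x : ℝ) ≤ ω * n}) (by simpa using hM₂)
  have hn' : (0 : ℝ) < n := by exact_mod_cast hn0
  refine ⟨randomShiftCode _ (fun j => (z j : Fin n → Fin q)) (ρ * n),
    randomShiftCode_isFingerprinting (Subtype.val_injective.comp z.injective)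
      (w := ω * n) (τ := (((q : ℝ) - 1) / q + δ) * n) (fun j => (z j).2) ?_ ?_ (by positivity) hε
      ?_ ?_⟩
  · rw [h2a, hδ]
    exact le_of_eq (by ring)
  · nlinarith
  · exact (card_heavy_le hq hδ0 hn0).trans (by gcongr)
  · refine le_trans ?_ hexp
    have hsplit : (q : ℝ) ^ (-(n * (1 - qEntropy q ρ - R₁))) =
        (q : ℝ) ^ ((n : ℝ) * R₁) * ((q : ℝ) ^ (n * qEntropy q ρ) / (q : ℝ) ^ n) := by
      rw [← Real.rpow_natCast (q : ℝ) n, ← Real.rpow_sub (by linarith),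
        ← Real.rpow_add (by linarith)]
      congr 1
      ring
    rw [hsplit]
    gcongr
    · exact Nat.floor_le (by positivity)
    · exact card_ball_le hq (by linarith) (by linarith) n
end

section
/- Let t ≥ 2 and q ≥ 2, and suppose R_1, R_2 ≥ 0 are such that there exists ω ≥ 0 with (t−1)/t · (1 − 1/q^{t−1}) + ω ≤ (q−1)/q, R_1 < 1 − h( (t−1)/t · (1 − 1/q^{t−1}) + ω ), and R_2 < h(ω). Then (R_1, R_2) is an achievable rate pair for q-ary (t,1)-fingerprinting: for every ε > 0 there exists n_0 such that for every n ≥ n_0 there is an (n, ⌊q^{nR_1}⌋, ⌊q^{nR_2}⌋)_q two-level randomized code that is (t,1)-fingerprinting with ε-error. -/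
/-- Summing a product weight against a function of some of the coordinates only involves
the weights of those coordinates. -/
theorem sum_pi_marginal {I J B : Type*} [Fintype I] [Fintype J] [Fintype B] [DecidableEq I]
    [DecidableEq J] [DecidableEq B] (w : I → B → ℝ) (hw : ∀ v, ∑ b, w v b = 1) (u : J → I)
    (hu : Function.Injective u) (F : (J → B) → ℝ) :
    ∑ x : I → B, (∏ v, w v (x v)) * F (x ∘ u) =
      ∑ X : J → B, (∏ j, w (u j) (X j)) * F X := by
  have key : ∀ X : J → B, ∑ x : I → B, (if x ∘ u = X then ∏ v, w v (x v) else 0) =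
      ∏ j, w (u j) (X j) := by
    intro X
    have h1 : ∀ x : I → B, (if x ∘ u = X then ∏ v, w v (x v) else 0) =
        ∏ v, (if ∀ j, u j = v → x v = X j then w v (x v) else 0) := by
      intro x
      by_cases hx : x ∘ u = X
      · rw [if_pos hx]
        refine Finset.prod_congr rfl fun v _ => ?_
        rw [if_pos]
        rintro j rfl
        exact congrFun hx j
      · rw [if_neg hx]
        obtain ⟨j, hj⟩ := Function.ne_iff.mp hx
        symm
        refine Finset.prod_eq_zero (Finset.mem_univ (u j)) ?_
        rw [if_neg]
        exact fun h => hj (h j rfl)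
    simp_rw [h1]
    rw [← Fintype.prod_sum (fun v b => if ∀ j, u j = v → b = X j then w v b else 0)]
    symm
    refine Fintype.prod_of_injective u hu _ _ ?_ ?_
    · intro v hv
      rw [← hw v]
      refine Finset.sum_congr rfl fun b _ => ?_
      rw [if_pos]
      exact fun j hj => (hv ⟨j, hj⟩).elim
    · intro j
      rw [Finset.sum_eq_single (X j)]
      · rw [if_pos]
        intro i hi
        rw [hu hi]
      · intro b _ hb
        rw [if_neg]
        exact fun h => hb (h j rfl)
      · simp
  simp_rw [← key, Finset.sum_mul]
  rw [Finset.sum_comm]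
  refine Finset.sum_congr rfl fun x _ => ?_
  rw [Finset.sum_eq_single (x ∘ u)]
  · simp
  · intro X _ hX
    rw [if_neg (Ne.symm hX), zero_mul]
  · simp

/-- A Chernoff bound with a rate that is uniform in the (not necessarily identical) factors. -/
theorem exists_chernoff (p η : ℝ) (hp : 0 ≤ p) (hp1 : p ≤ 1) (hη : 0 < η) :
    ∃ ρ : ℝ, 0 ≤ ρ ∧ ρ < 1 ∧ ∀ (n : ℕ) {B : Type} [Fintype B] (w : Fin n → B → ℝ)
      (S : Fin n → B → Prop) [∀ l, DecidablePred (S l)], (∀ l b, 0 ≤ w l b) →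
      (∀ l, ∑ b, w l b = 1) → (∀ l, ∑ b, (if S l b then w l b else 0) ≤ p) →
      ∑ b : Fin n → B, (∏ l, w l (b l)) *
        (if (n : ℝ) * (p + η) < (Finset.univ.filter fun l => S l (b l)).card then 1 else 0)
        ≤ ρ ^ n := by
  set c : ℝ := 1 + η / 2 with hc
  have hc1 : 1 < c := by linarith
  have hc0 : 0 < c := by linarith
  refine ⟨(1 + p * (c - 1)) * c ^ (-(p + η)), mul_nonneg (by nlinarith) (by positivity), ?_, ?_⟩
  · have h1 : p * (c - 1) < (p + η) * Real.log c := by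
      have h2 := Real.one_sub_inv_le_log_of_pos hc0
      have h3 : p * (c - 1) < (p + η) * (1 - c⁻¹) := by
        have : 1 - c⁻¹ = (c - 1) / c := by field_simp
        rw [this, ← mul_div_assoc, lt_div_iff₀ hc0]
        have : p * c < p + η := by rw [hc]; nlinarith
        nlinarith
      nlinarith
    have h4 : 1 + p * (c - 1) < c ^ (p + η) := by
      rw [Real.rpow_def_of_pos hc0]
      have := Real.add_one_le_exp (p * (c - 1))
      have := Real.exp_lt_exp.mpr h1
      rw [mul_comm (Real.log c)]
      linarith
    rw [Real.rpow_neg hc0.le, ← div_eq_mul_inv, div_lt_one (by positivity)]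
    exact h4
  · intro n B _ w S _ hw0 hw1 hS
    have hstep : ∀ b : Fin n → B, (∏ l, w l (b l)) *
        (if (n : ℝ) * (p + η) < (Finset.univ.filter fun l => S l (b l)).card then 1 else 0) ≤
        (∏ l, w l (b l) * (if S l (b l) then c else 1)) * (c ^ (-(p + η))) ^ n := by
      intro b
      rw [Finset.prod_mul_distrib, mul_assoc]
      refine mul_le_mul_of_nonneg_left ?_ (Finset.prod_nonneg fun l _ => hw0 _ _)
      rw [Finset.prod_ite, Finset.prod_const, Finset.prod_const_one, mul_one]
      split_ifs with h
      · rw [← Real.rpow_natCast c, ← Real.rpow_natCast (c ^ _), ← Real.rpow_mul hc0.le,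
          ← Real.rpow_add hc0]
        apply Real.one_le_rpow hc1.le
        linarith
      · positivity
    refine (Finset.sum_le_sum fun b _ => hstep b).trans ?_
    rw [← Finset.sum_mul, mul_pow,
      ← Fintype.prod_sum (fun l b => w l b * (if S l b then c else 1))]
    refine mul_le_mul_of_nonneg_right ?_ (by positivity)
    calc ∏ l : Fin n, ∑ b, w l b * (if S l b then c else 1)
        ≤ ∏ l : Fin n, (1 + p * (c - 1)) := by
          refine Finset.prod_le_prod (fun l _ => Finset.sum_nonneg fun b _ =>
            mul_nonneg (hw0 _ _) (by split_ifs <;> linarith)) fun l _ => ?_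
          have : ∀ b, w l b * (if S l b then c else 1) =
              w l b + (if S l b then w l b else 0) * (c - 1) := by
            intro b; split_ifs <;> ring
          simp_rw [this]
          rw [Finset.sum_add_distrib, ← Finset.sum_mul, hw1]
          have := hS l
          nlinarith
      _ = _ := by simp

/-- The volume of a Hamming ball, by the exponential moment method. -/
theorem hamming_ball_bound {q n : ℕ} (hq : 2 ≤ q) (φ r : ℝ) (h0 : 0 < φ) (h1 : φ ≤ 1)
    (y : Fin n → Fin q) :
    ((q : ℝ) ^ n)⁻¹ * ∑ a : Fin n → Fin q, (if (hammingDist y a : ℝ) ≤ r then (1 : ℝ) else 0) ≤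
      ((1 + (q - 1) * φ) / q) ^ n * φ ^ (-r) := by
  have hstep : ∀ a : Fin n → Fin q, (if (hammingDist y a : ℝ) ≤ r then (1 : ℝ) else 0) ≤
      (∏ l, if y l ≠ a l then φ else 1) * φ ^ (-r) := by
    intro a
    rw [Finset.prod_ite, Finset.prod_const, Finset.prod_const_one, mul_one]
    split_ifs with h
    · rw [← Real.rpow_natCast φ, ← Real.rpow_add h0]
      apply Real.one_le_rpow_of_pos_of_le_one_of_nonpos h0 h1
      simp only [hammingDist] at h
      linarith
    · positivity
  have hsum : ∑ a : Fin n → Fin q, (∏ l, if y l ≠ a l then φ else 1) =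
      (1 + (q - 1) * φ) ^ n := by
    rw [← Fintype.prod_sum (fun l b => if y l ≠ b then φ else 1)]
    have : ∀ l, ∑ b, (if y l ≠ b then φ else 1) = 1 + (q - 1) * φ := by
      intro l
      have : ∀ b, (if y l ≠ b then φ else 1) = φ + (if y l = b then (1 - φ) else 0) := by
        intro b; by_cases h : y l = b <;> simp [h]
      simp_rw [this]
      rw [Finset.sum_add_distrib, Finset.sum_ite_eq]
      simp
      ring
    rw [Finset.prod_congr rfl fun l _ => this l]
    simp
  have hq0 : (0 : ℝ) < q := by positivity
  calc _ ≤ ((q : ℝ) ^ n)⁻¹ * ∑ a : Fin n → Fin q,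
        (∏ l, if y l ≠ a l then φ else 1) * φ ^ (-r) :=
        mul_le_mul_of_nonneg_left (Finset.sum_le_sum fun a _ => hstep a) (by positivity)
    _ = _ := by
        rw [← Finset.sum_mul, hsum, div_pow]
        field_simp

/-- The `q`-ary symmetric channel with crossover probability `ω`. -/
noncomputable def symChannel (q : ℕ) (ω : ℝ) (a b : Fin q) : ℝ :=
  if a = b then 1 - ω else ω / (q - 1)

/-- The memoryless extension of the `q`-ary symmetric channel. -/
noncomputable def symChannelPi (q n : ℕ) (ω : ℝ) (a b : Fin n → Fin q) : ℝ :=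
  ∏ l, symChannel q ω (a l) (b l)

theorem symChannel_comm {q : ℕ} (ω : ℝ) (a b : Fin q) :
    symChannel q ω a b = symChannel q ω b a := by
  simp only [symChannel, eq_comm]

theorem symChannelPi_comm {q n : ℕ} (ω : ℝ) (a b : Fin n → Fin q) :
    symChannelPi q n ω a b = symChannelPi q n ω b a := by
  simp only [symChannelPi]
  exact Finset.prod_congr rfl fun l _ => symChannel_comm _ _ _

theorem symChannel_nonneg {q : ℕ} (hq : 2 ≤ q) {ω : ℝ} (h0 : 0 ≤ ω) (h1 : ω ≤ 1)
    (a b : Fin q) : 0 ≤ symChannel q ω a b := by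
  have : (2 : ℝ) ≤ q := by exact_mod_cast hq
  unfold symChannel
  split_ifs
  · linarith
  · exact div_nonneg h0 (by linarith)

theorem symChannelPi_nonneg {q n : ℕ} (hq : 2 ≤ q) {ω : ℝ} (h0 : 0 ≤ ω) (h1 : ω ≤ 1)
    (a b : Fin n → Fin q) : 0 ≤ symChannelPi q n ω a b :=
  Finset.prod_nonneg fun _ _ => symChannel_nonneg hq h0 h1 _ _

theorem sum_symChannel_eq {q : ℕ} (ω : ℝ) (a : Fin q) :
    ∑ b, (if a = b then symChannel q ω a b else 0) = 1 - ω := by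
  simp [symChannel]

theorem sum_symChannel {q : ℕ} (hq : 2 ≤ q) (ω : ℝ) (a : Fin q) :
    ∑ b, symChannel q ω a b = 1 := by
  have h2 : (2 : ℝ) ≤ q := by exact_mod_cast hq
  have h3 : (q : ℝ) - 1 ≠ 0 := by linarith
  have : ∀ b, symChannel q ω a b =
      ω / (q - 1) + (if a = b then (1 - ω - ω / (q - 1)) else 0) := by
    intro b; by_cases h : a = b <;> simp [symChannel, h]
  simp_rw [this]
  rw [Finset.sum_add_distrib, Finset.sum_ite_eq]
  simp
  field_simp
  ring

theorem sum_symChannelPi {q n : ℕ} (hq : 2 ≤ q) (ω : ℝ) (a : Fin n → Fin q) :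
    ∑ b, symChannelPi q n ω a b = 1 := by
  unfold symChannelPi
  rw [← Fintype.prod_sum (fun l b => symChannel q ω (a l) b)]
  simp [sum_symChannel hq]

theorem symChannelPi_eq {q n : ℕ} (hq : 2 ≤ q) {ω : ℝ} (h1 : ω < 1) (a b : Fin n → Fin q) :
    symChannelPi q n ω a b =
      (1 - ω) ^ n * (ω / ((q - 1) * (1 - ω))) ^ hammingDist a b := by
  have h2 : (2 : ℝ) ≤ q := by exact_mod_cast hq
  have h3 : (q : ℝ) - 1 ≠ 0 := by linarith
  have h4 : 1 - ω ≠ 0 := by linarith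
  have : ∀ l, symChannel q ω (a l) (b l) =
      (1 - ω) * (if a l ≠ b l then ω / ((q - 1) * (1 - ω)) else 1) := by
    intro l
    unfold symChannel
    by_cases h : a l = b l
    · simp [h]
    · simp only [h, if_false, ne_eq, not_false_eq_true, if_true]
      field_simp
  unfold symChannelPi
  simp_rw [this]
  rw [Finset.prod_mul_distrib, Finset.prod_ite, Finset.prod_const, Finset.prod_const,
    Finset.prod_const_one, mul_one, Finset.card_univ, Fintype.card_fin, hammingDist]

theorem card_mul_inv_card_pow_le_sum_pow {q : ℕ} (hq : 0 < q) (f : Fin q → ℝ)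
    (h0 : ∀ b, 0 ≤ f b) (h1 : ∑ b, f b = 1) (m : ℕ) :
    (q : ℝ) * (q : ℝ)⁻¹ ^ m ≤ ∑ b, f b ^ m := by
  have hq0 : (0 : ℝ) < q := by exact_mod_cast hq
  cases m with
  | zero => simp
  | succ k =>
    have := pow_sum_div_card_le_sum_pow (s := Finset.univ) (f := f) (n := k) (fun b _ => h0 b)
    rw [h1] at this
    refine le_trans (le_of_eq ?_) this
    simp
    field_simp
    ring

/-- Codeword symbols generated from uniform group symbols all agree with probability at least
that of independent uniform symbols. -/
theorem inv_pow_le_sum_agree {q s : ℕ} (hq : 0 < q) {G : Type*} [Fintype G] [DecidableEq G]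
    (W : Fin q → Fin q → ℝ) (h0 : ∀ a b, 0 ≤ W a b) (h1 : ∀ a, ∑ b, W b a = 1)
    (g : Fin s → G) :
    (q : ℝ) * (q : ℝ)⁻¹ ^ s ≤
      (q : ℝ)⁻¹ ^ Fintype.card G * ∑ σ : G → Fin q, ∑ a, ∏ i, W (σ (g i)) a := by
  have hq0 : (0 : ℝ) < q := by exact_mod_cast hq
  have key : ∀ a, (q : ℝ) ^ Fintype.card G * (q : ℝ)⁻¹ ^ s ≤
      ∑ σ : G → Fin q, ∏ i, W (σ (g i)) a := by
    intro a
    have e : ∀ σ : G → Fin q, ∏ i, W (σ (g i)) a =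
        ∏ γ, W (σ γ) a ^ (Finset.univ.filter fun i => g i = γ).card := by
      intro σ
      rw [← Finset.prod_fiberwise Finset.univ g]
      refine Finset.prod_congr rfl fun γ _ => ?_
      rw [← Finset.prod_const]
      refine Finset.prod_congr rfl fun i hi => ?_
      rw [(Finset.mem_filter.mp hi).2]
    simp_rw [e]
    rw [← Fintype.prod_sum
      (fun γ b => W b a ^ (Finset.univ.filter fun i => g i = γ).card)]
    calc (q : ℝ) ^ Fintype.card G * (q : ℝ)⁻¹ ^ s
        = ∏ γ : G, ((q : ℝ) * (q : ℝ)⁻¹ ^ (Finset.univ.filter fun i => g i = γ).card) := by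
          rw [Finset.prod_mul_distrib, Finset.prod_const, Finset.prod_pow_eq_pow_sum,
            ← Finset.card_eq_sum_card_fiberwise (fun i _ => Finset.mem_coe.mpr
              (Finset.mem_univ (g i)))]
          simp
      _ ≤ _ := Finset.prod_le_prod (fun γ _ => by positivity) fun γ _ =>
          card_mul_inv_card_pow_le_sum_pow hq _ (fun b => h0 b a) (h1 a) _
  rw [Finset.sum_comm]
  calc (q : ℝ) * (q : ℝ)⁻¹ ^ s
      = (q : ℝ)⁻¹ ^ Fintype.card G *
          ∑ _a : Fin q, (q : ℝ) ^ Fintype.card G * (q : ℝ)⁻¹ ^ s := by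
        simp
        field_simp
    _ ≤ _ := mul_le_mul_of_nonneg_left (Finset.sum_le_sum fun a _ => key a) (by positivity)

/-- The number of coordinates in which the words `X i` do not all agree. -/
noncomputable def numMixed {q n s : ℕ} (X : Fin s → Fin n → Fin q) : ℕ :=
  (Finset.univ.filter fun l => ¬ ∀ i j, X i l = X j l).card

theorem sum_ite_const {q s : ℕ} (hs : 0 < s) (f : (Fin s → Fin q) → ℝ) :
    ∑ X : Fin s → Fin q, (if ∀ i j, X i = X j then f X else 0) = ∑ a, f fun _ => a := by
  have : ∀ X : Fin s → Fin q, (if ∀ i j, X i = X j then f X else 0) =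
      ∑ a, if X = (fun _ => a) then f X else 0 := by
    intro X
    split_ifs with h
    · rw [Finset.sum_eq_single (X ⟨0, hs⟩)]
      · rw [if_pos]
        exact funext fun i => h _ _
      · intro b _ hb
        rw [if_neg]
        rintro rfl
        exact hb rfl
      · simp
    · symm
      refine Finset.sum_eq_zero fun a _ => ?_
      rw [if_neg]
      rintro rfl
      exact h fun _ _ => rfl
  simp_rw [this]
  rw [Finset.sum_comm]
  simp

theorem sum_prod_symChannel {q s : ℕ} (hq : 2 ≤ q) (ω : ℝ) {G : Type*} [Fintype G]
    [DecidableEq G] (g : Fin s → G) :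
    ∑ b : (G → Fin q) × (Fin s → Fin q),
      (q : ℝ)⁻¹ ^ Fintype.card G * ∏ i, symChannel q ω (b.1 (g i)) (b.2 i) = 1 := by
  have hq0 : (0 : ℝ) < q := by positivity
  rw [Fintype.sum_prod_type]
  have : ∀ σ : G → Fin q, ∑ X : Fin s → Fin q,
      (q : ℝ)⁻¹ ^ Fintype.card G * ∏ i, symChannel q ω (σ (g i)) (X i) =
      (q : ℝ)⁻¹ ^ Fintype.card G := by
    intro σ
    rw [← Finset.mul_sum, ← Fintype.prod_sum (fun i b => symChannel q ω (σ (g i)) b)]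
    simp [sum_symChannel hq]
  rw [Finset.sum_congr rfl fun σ _ => this σ]
  simp [hq0.ne']

theorem exists_numMixed_bound (t q : ℕ) (hq : 2 ≤ q) (ω η : ℝ) (h0 : 0 ≤ ω)
    (h1 : ω ≤ 1) (hη : 0 < η) :
    ∃ ρ : ℝ, 0 ≤ ρ ∧ ρ < 1 ∧ ∀ (n s : ℕ) {G : Type} [Fintype G] [DecidableEq G]
      (g : Fin s → G), 0 < s → s ≤ t →
      ∑ σ : G → Fin n → Fin q, ((q : ℝ) ^ n)⁻¹ ^ Fintype.card G *
        ∑ X : Fin s → Fin n → Fin q, (∏ i, symChannelPi q n ω (σ (g i)) (X i)) *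
          (if (n : ℝ) * (1 - 1 / (q : ℝ) ^ (t - 1) + η) < numMixed X then 1 else 0)
        ≤ ρ ^ n := by
  have hq0 : (0 : ℝ) < q := by positivity
  have hq1 : (1 : ℝ) ≤ q := by exact_mod_cast (by omega : 1 ≤ q)
  have hp : 0 ≤ 1 - 1 / (q : ℝ) ^ (t - 1) := by
    rw [sub_nonneg]
    exact (div_le_one (by positivity)).mpr (one_le_pow₀ hq1)
  have hp1 : 1 - 1 / (q : ℝ) ^ (t - 1) ≤ 1 := by
    have : 0 ≤ 1 / (q : ℝ) ^ (t - 1) := by positivity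
    linarith
  obtain ⟨ρ, hρ0, hρ1, H⟩ := exists_chernoff _ η hp hp1 hη
  refine ⟨ρ, hρ0, hρ1, fun n s G _ _ g hs hst => ?_⟩
  have hW0 := symChannel_nonneg hq h0 h1
  have hb := H n (B := (G → Fin q) × (Fin s → Fin q))
    (fun _ b => (q : ℝ)⁻¹ ^ Fintype.card G * ∏ i, symChannel q ω (b.1 (g i)) (b.2 i))
    (fun _ b => ¬ ∀ i j, b.2 i = b.2 j)
    (fun _ b => mul_nonneg (by positivity) (Finset.prod_nonneg fun i _ => hW0 _ _))
    (fun _ => sum_prod_symChannel hq ω g) ?_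
  · refine le_trans (le_of_eq ?_) hb
    simp_rw [Finset.mul_sum]
    rw [← Fintype.sum_prod_type' (f := fun (σ : G → Fin n → Fin q) (X : Fin s → Fin n → Fin q) =>
      ((q : ℝ) ^ n)⁻¹ ^ Fintype.card G * ((∏ i, symChannelPi q n ω (σ (g i)) (X i)) *
          (if (n : ℝ) * (1 - 1 / (q : ℝ) ^ (t - 1) + η) < numMixed X then 1 else 0)))]
    refine Fintype.sum_equiv
      { toFun := fun k l => (fun γ => k.1 γ l, fun i => k.2 i l)
        invFun := fun b => (fun γ l => (b l).1 γ, fun i l => (b l).2 i)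
        left_inv := fun _ => rfl
        right_inv := fun _ => rfl } _ _ ?_
    rintro ⟨σ, X⟩
    simp only [Equiv.coe_fn_mk, numMixed, symChannelPi]
    rw [Finset.prod_mul_distrib, Finset.prod_comm, Finset.prod_const, ← mul_assoc]
    congr 2
    simp [← pow_mul, mul_comm]
  · intro _
    have e : ∀ b : (G → Fin q) × (Fin s → Fin q),
        (if ¬ ∀ i j, b.2 i = b.2 j then
          (q : ℝ)⁻¹ ^ Fintype.card G * ∏ i, symChannel q ω (b.1 (g i)) (b.2 i) else 0) =
        (q : ℝ)⁻¹ ^ Fintype.card G * ∏ i, symChannel q ω (b.1 (g i)) (b.2 i) -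
        (q : ℝ)⁻¹ ^ Fintype.card G * (if ∀ i j, b.2 i = b.2 j then
          ∏ i, symChannel q ω (b.1 (g i)) (b.2 i) else 0) := by
      intro b
      by_cases h : ∀ i j, b.2 i = b.2 j
      · rw [if_neg (not_not.mpr h), if_pos h, sub_self]
      · rw [if_pos h, if_neg h, mul_zero, sub_zero]
    simp_rw [e]
    rw [Finset.sum_sub_distrib, sum_prod_symChannel hq ω g, ← Finset.mul_sum,
      Fintype.sum_prod_type]
    simp_rw [sum_ite_const hs fun X => ∏ i, symChannel q ω (_ : Fin q) (X i)]
    have h2 := inv_pow_le_sum_agree (by omega : 0 < q) (symChannel q ω) hW0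
      (fun a => by simp_rw [symChannel_comm ω _ a]; exact sum_symChannel hq ω a) g
    have h3 : 1 / (q : ℝ) ^ (t - 1) ≤ (q : ℝ) * (q : ℝ)⁻¹ ^ s := by
      obtain ⟨k, rfl⟩ : ∃ k, s = k + 1 := ⟨s - 1, by omega⟩
      have : (q : ℝ) * (q : ℝ)⁻¹ ^ (k + 1) = 1 / (q : ℝ) ^ k := by
        rw [pow_succ, inv_pow]; field_simp
      rw [this]
      exact one_div_le_one_div_of_le (by positivity) (pow_le_pow_right₀ hq1 (by omega))
    linarith

theorem sum_resample {G A : Type*} [Fintype G] [DecidableEq G] [Fintype A] [Nonempty A]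
    (g : G) (H : (G → A) → A → ℝ) (hH : ∀ σ a b, H (Function.update σ g a) b = H σ b) :
    ∑ σ, H σ (σ g) = ∑ σ, (Fintype.card A : ℝ)⁻¹ * ∑ a, H σ a := by
  have e : ∑ k : (G → A) × A, H k.1 (k.1 g) = ∑ k : (G → A) × A, H k.1 k.2 := by
    refine Fintype.sum_equiv
      { toFun := fun k => (Function.update k.1 g k.2, k.1 g)
        invFun := fun k => (Function.update k.1 g k.2, k.1 g)
        left_inv := fun k => by simp
        right_inv := fun k => by simp } _ _ ?_
    rintro ⟨σ, a⟩
    simp [hH]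
  rw [Fintype.sum_prod_type, Fintype.sum_prod_type] at e
  rw [← Finset.mul_sum, ← e]
  simp only [Finset.sum_const, Finset.card_univ, nsmul_eq_mul]
  rw [← Finset.mul_sum]
  have : (Fintype.card A : ℝ) ≠ 0 := by simp
  field_simp

/-- A key consists of one centre for every group and one codeword for every user. -/
abbrev CloudKey (q n M₁ M₂ : ℕ) :=
  (Fin M₁ → Fin n → Fin q) × (Fin M₁ × Fin M₂ → Fin n → Fin q)

/-- The centres are independent and uniform; the codewords are independent outputs of the
`q`-ary symmetric channel on the centre of the group. -/
noncomputable def cloudProb {q n M₁ M₂ : ℕ} (ω : ℝ) (k : CloudKey q n M₁ M₂) : ℝ :=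
  ((q : ℝ) ^ n)⁻¹ ^ M₁ * ∏ v, symChannelPi q n ω (k.1 v.1) (k.2 v)

section CloudProb

variable {q n M₁ M₂ : ℕ}

theorem cloudProb_nonneg (hq : 2 ≤ q) {ω : ℝ} (h0 : 0 ≤ ω) (h1 : ω ≤ 1)
    (k : CloudKey q n M₁ M₂) : 0 ≤ cloudProb ω k :=
  mul_nonneg (by positivity) (Finset.prod_nonneg fun _ _ => symChannelPi_nonneg hq h0 h1 _ _)

theorem sum_cloudProb_mul (hq : 2 ≤ q) (ω : ℝ) {J : Type*} [Fintype J] [DecidableEq J]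
    (u : J → Fin M₁ × Fin M₂) (hu : Function.Injective u)
    (F : (Fin M₁ → Fin n → Fin q) → (J → Fin n → Fin q) → ℝ) :
    ∑ k : CloudKey q n M₁ M₂, cloudProb ω k * F k.1 (k.2 ∘ u) =
      ∑ σ : Fin M₁ → Fin n → Fin q, ((q : ℝ) ^ n)⁻¹ ^ M₁ *
        ∑ X : J → Fin n → Fin q, (∏ j, symChannelPi q n ω (σ (u j).1) (X j)) * F σ X := by
  rw [Fintype.sum_prod_type]
  refine Finset.sum_congr rfl fun σ _ => ?_
  rw [← sum_pi_marginal (fun v => symChannelPi q n ω (σ v.1))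
    (fun v => sum_symChannelPi hq ω _) u hu, Finset.mul_sum]
  exact Finset.sum_congr rfl fun x _ => mul_assoc _ _ _

theorem sum_centre_weight (hq : 2 ≤ q) :
    ∑ _σ : Fin M₁ → Fin n → Fin q, ((q : ℝ) ^ n)⁻¹ ^ M₁ = 1 := by
  have hq0 : (q : ℝ) ≠ 0 := by positivity
  simp [hq0]

theorem sum_centre_weight_mul_le (hq : 2 ≤ q) (f : (Fin M₁ → Fin n → Fin q) → ℝ) (c : ℝ)
    (hf : ∀ σ, f σ ≤ c) :
    ∑ σ : Fin M₁ → Fin n → Fin q, ((q : ℝ) ^ n)⁻¹ ^ M₁ * f σ ≤ c := by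
  calc _ ≤ ∑ σ : Fin M₁ → Fin n → Fin q, ((q : ℝ) ^ n)⁻¹ ^ M₁ * c :=
        Finset.sum_le_sum fun σ _ => mul_le_mul_of_nonneg_left (hf σ) (by positivity)
    _ = c := by rw [← Finset.sum_mul, sum_centre_weight hq, one_mul]

theorem sum_cloudProb (hq : 2 ≤ q) (ω : ℝ) :
    ∑ k : CloudKey q n M₁ M₂, cloudProb ω k = 1 := by
  have := sum_cloudProb_mul (n := n) hq ω (fun i : Empty => (i.elim : Fin M₁ × Fin M₂))
    (fun i => i.elim) (fun _ _ => 1)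
  simp only [mul_one] at this
  rw [this, ← sum_centre_weight (M₁ := M₁) (n := n) hq]
  simp

theorem sum_cloudProb_mul_le (hq : 2 ≤ q) {ω : ℝ} (h0 : 0 ≤ ω) (h1 : ω ≤ 1)
    (f : CloudKey q n M₁ M₂ → ℝ) (c : ℝ) (hf : ∀ k, f k ≤ c) :
    ∑ k, cloudProb ω k * f k ≤ c := by
  calc _ ≤ ∑ k : CloudKey q n M₁ M₂, cloudProb ω k * c :=
        Finset.sum_le_sum fun k _ =>
          mul_le_mul_of_nonneg_left (hf k) (cloudProb_nonneg hq h0 h1 k)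
    _ = c := by rw [← Finset.sum_mul, sum_cloudProb hq, one_mul]

theorem sum_cloudProb_mul_single (hq : 2 ≤ q) (ω : ℝ) (v : Fin M₁ × Fin M₂)
    (F : (Fin M₁ → Fin n → Fin q) → (Fin n → Fin q) → ℝ) :
    ∑ k : CloudKey q n M₁ M₂, cloudProb ω k * F k.1 (k.2 v) =
      ∑ σ : Fin M₁ → Fin n → Fin q, ((q : ℝ) ^ n)⁻¹ ^ M₁ *
        ∑ a, symChannelPi q n ω (σ v.1) a * F σ a := by
  refine (sum_cloudProb_mul hq ω (fun _ : Unit => v) (fun _ _ _ => rfl)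
    (fun σ X => F σ (X ()))).trans ?_
  refine Finset.sum_congr rfl fun σ _ => congrArg _ ?_
  refine Fintype.sum_equiv (Equiv.funUnique Unit _) _ _ fun X => ?_
  simp

theorem sum_cloudProb_mul_pair (hq : 2 ≤ q) (ω : ℝ) {v w : Fin M₁ × Fin M₂} (hvw : v ≠ w)
    (F : (Fin M₁ → Fin n → Fin q) → (Fin n → Fin q) → (Fin n → Fin q) → ℝ) :
    ∑ k : CloudKey q n M₁ M₂, cloudProb ω k * F k.1 (k.2 v) (k.2 w) =
      ∑ σ : Fin M₁ → Fin n → Fin q, ((q : ℝ) ^ n)⁻¹ ^ M₁ *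
        ∑ a, symChannelPi q n ω (σ v.1) a *
          ∑ b, symChannelPi q n ω (σ w.1) b * F σ a b := by
  have hinj : Function.Injective ![v, w] := by
    intro i j hij
    fin_cases i <;> fin_cases j <;> simp_all
  have := sum_cloudProb_mul (n := n) hq ω ![v, w] hinj (fun σ X => F σ (X 0) (X 1))
  simp only [Function.comp_apply, Matrix.cons_val_zero, Matrix.cons_val_one] at this
  rw [this]
  refine Finset.sum_congr rfl fun σ _ => congrArg _ ?_
  simp_rw [Finset.mul_sum]
  rw [← Fintype.sum_prod_type' (f := fun a b => symChannelPi q n ω (σ v.1) a *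
          (symChannelPi q n ω (σ w.1) b * F σ a b))]
  refine Fintype.sum_equiv (finTwoArrowEquiv _) _ _ fun X => ?_
  simp [Fin.prod_univ_two, mul_assoc]

/-- The centre of a group is independent of the codewords of the users in other groups. -/
theorem sum_cloudProb_mul_resample (hq : 2 ≤ q) (ω : ℝ) {J : Type*} [Fintype J] [DecidableEq J]
    (u : J → Fin M₁ × Fin M₂) (hu : Function.Injective u) (g : Fin M₁)
    (hg : ∀ j, (u j).1 ≠ g) (F : (J → Fin n → Fin q) → (Fin n → Fin q) → ℝ) :
    ∑ k : CloudKey q n M₁ M₂, cloudProb ω k * F (k.2 ∘ u) (k.1 g) =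
      ∑ k : CloudKey q n M₁ M₂, cloudProb ω k *
        (((q : ℝ) ^ n)⁻¹ * ∑ a, F (k.2 ∘ u) a) := by
  have : NeZero q := ⟨by omega⟩
  rw [sum_cloudProb_mul hq ω u hu (fun σ X => F X (σ g)),
    sum_cloudProb_mul hq ω u hu (fun _ X => ((q : ℝ) ^ n)⁻¹ * ∑ a, F X a),
    sum_resample g (fun σ b => ((q : ℝ) ^ n)⁻¹ ^ M₁ *
        ∑ X : J → Fin n → Fin q, (∏ j, symChannelPi q n ω (σ (u j).1) (X j)) * F X b)]
  · refine Finset.sum_congr rfl fun σ _ => ?_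
    simp_rw [← Finset.mul_sum]
    rw [Finset.sum_comm]
    simp_rw [← Finset.mul_sum]
    simp only [Fintype.card_pi, Fintype.card_fin, Finset.prod_const, Finset.card_univ,
      Nat.cast_pow]
    simp_rw [mul_left_comm _ (((q : ℝ) ^ n)⁻¹)]
    rw [← Finset.mul_sum]
    ring
  · intro σ a b
    simp only [Function.update_of_ne (hg _)]

end CloudProb

open scoped Classical in
/-- The group decoder looks for a centre within distance `r`, the user decoder for an exact
match. -/
noncomputable def cloudCode {q n M₁ M₂ : ℕ} (r : ℝ) (k : CloudKey q n M₁ M₂) :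
    TwoLevelCode q n M₁ M₂ where
  enc := k.2
  dec1 y := if h : ∃ g, (hammingDist y (k.1 g) : ℝ) ≤ r then some h.choose else none
  dec2 y := if h : ∃ v, k.2 v = y then some h.choose else none

/-- The randomized code whose key is distributed according to `cloudProb`. -/
noncomputable def cloudRandCode {q : ℕ} (n M₁ M₂ : ℕ) (hq : 2 ≤ q) (ω r : ℝ) (h0 : 0 ≤ ω)
    (h1 : ω ≤ 1) : RandCode q n M₁ M₂ where
  κ := Fintype.card (CloudKey q n M₁ M₂)
  π i := cloudProb ω ((Fintype.equivFin (CloudKey q n M₁ M₂)).symm i)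
  π_nonneg _ := cloudProb_nonneg hq h0 h1 _
  π_sum := by
    rw [Equiv.sum_comp (Fintype.equivFin (CloudKey q n M₁ M₂)).symm (cloudProb ω)]
    exact sum_cloudProb hq ω
  code i := cloudCode r ((Fintype.equivFin (CloudKey q n M₁ M₂)).symm i)

section Errors

variable {q n M₁ M₂ : ℕ}

open scoped Classical in
theorem e1_cloudRandCode (hq : 2 ≤ q) (ω r : ℝ) (h0 : 0 ≤ ω) (h1 : ω ≤ 1) {s : ℕ}
    (u : Fin s → Fin M₁ × Fin M₂) (V : (Fin s → Fin n → Fin q) → (Fin n → Fin q) → ℝ) :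
    e1 (cloudRandCode n M₁ M₂ hq ω r h0 h1) u V =
      ∑ k : CloudKey q n M₁ M₂, cloudProb ω k *
        ∑ y ∈ Finset.univ.filter
          (fun y : Fin n → Fin q => ¬ ∃ i, (cloudCode r k).dec1 y = some (u i).1),
          V (k.2 ∘ u) y :=
  Equiv.sum_comp (Fintype.equivFin (CloudKey q n M₁ M₂)).symm fun k => cloudProb ω k *
        ∑ y ∈ Finset.univ.filter
          (fun y : Fin n → Fin q => ¬ ∃ i, (cloudCode r k).dec1 y = some (u i).1),
          V (k.2 ∘ u) y

open scoped Classical in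
theorem e2_cloudRandCode (hq : 2 ≤ q) (ω r : ℝ) (h0 : 0 ≤ ω) (h1 : ω ≤ 1) {s : ℕ}
    (u : Fin s → Fin M₁ × Fin M₂) (V : (Fin s → Fin n → Fin q) → (Fin n → Fin q) → ℝ) :
    e2 (cloudRandCode n M₁ M₂ hq ω r h0 h1) u V =
      ∑ k : CloudKey q n M₁ M₂, cloudProb ω k *
        ∑ y ∈ Finset.univ.filter
          (fun y : Fin n → Fin q => ¬ ∃ i, (cloudCode r k).dec2 y = some (u i)),
          V (k.2 ∘ u) y :=
  Equiv.sum_comp (Fintype.equivFin (CloudKey q n M₁ M₂)).symm fun k => cloudProb ω k *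
        ∑ y ∈ Finset.univ.filter
          (fun y : Fin n → Fin q => ¬ ∃ i, (cloudCode r k).dec2 y = some (u i)),
          V (k.2 ∘ u) y

theorem hammingDist_le_of_inEnvelope {s t : ℕ} (hs : 0 < s) (hst : s ≤ t)
    {X : Fin s → Fin n → Fin q} {y : Fin n → Fin q} (h : InEnvelope X y) :
    ∃ i, (hammingDist y (X i) : ℝ) ≤ ((t : ℝ) - 1) / t * numMixed X := by
  have h1 : ∑ i, hammingDist y (X i) ≤ (s - 1) * numMixed X := by
    simp only [hammingDist, numMixed, Finset.card_filter]
    rw [Finset.sum_comm, Finset.mul_sum]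
    refine Finset.sum_le_sum fun l _ => ?_
    rw [← Finset.card_filter]
    obtain ⟨i₀, hi₀⟩ := h l
    split_ifs with hm
    · rw [mul_zero, Nat.le_zero, Finset.card_eq_zero, Finset.filter_eq_empty_iff]
      intro i _
      rw [hi₀, not_not]
      by_contra hne
      exact hne (hm i₀ i)
    · rw [mul_one]
      calc _ ≤ (Finset.univ.erase i₀).card := by
            refine Finset.card_le_card fun i hi => ?_
            rw [Finset.mem_erase]
            refine ⟨?_, Finset.mem_univ _⟩
            rintro rfl
            exact (Finset.mem_filter.mp hi).2 hi₀
        _ = s - 1 := by simp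
  by_contra! hcon
  have hs0 : (0 : ℝ) < s := by exact_mod_cast hs
  have ht0 : (0 : ℝ) < t := by exact_mod_cast hs.trans_le hst
  have hst' : (s : ℝ) ≤ t := by exact_mod_cast hst
  have h2 : ∑ i : Fin s, ((t : ℝ) - 1) / t * numMixed X <
      ∑ i, (hammingDist y (X i) : ℝ) :=
    Finset.sum_lt_sum_of_nonempty ⟨⟨0, hs⟩, Finset.mem_univ _⟩ fun i _ => hcon i
  have h3 : ∑ i, (hammingDist y (X i) : ℝ) ≤ ((s : ℝ) - 1) * numMixed X := by
    have : ((s - 1 : ℕ) : ℝ) = (s : ℝ) - 1 := by rw [Nat.cast_sub hs, Nat.cast_one]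
    rw [← this]
    exact_mod_cast h1
  rw [Finset.sum_const, Finset.card_univ, Fintype.card_fin, nsmul_eq_mul, ← mul_assoc] at h2
  have h4 : ((s : ℝ) - 1) ≤ s * (((t : ℝ) - 1) / t) := by
    rw [← mul_div_assoc, le_div_iff₀ ht0]
    nlinarith
  have h5 := mul_le_mul_of_nonneg_right h4 (Nat.cast_nonneg (α := ℝ) (numMixed X))
  linarith

end Errors

theorem sum_symChannelPi_mul {q n : ℕ} (hq : 2 ≤ q) (ω : ℝ) (a : Fin n → Fin q) (c : ℝ) :
    ∑ b, symChannelPi q n ω a b * c = c := by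
  rw [← Finset.sum_mul, sum_symChannelPi hq, one_mul]

section Collisions

variable {q n M₁ M₂ : ℕ}

theorem sum_cloudProb_collision_same_group (hq : 2 ≤ q) {ω : ℝ} (h0 : 0 < ω) (h1 : ω < 1)
    (hψ : ω / ((q - 1) * (1 - ω)) ≤ 1) (m : ℝ) {v w : Fin M₁ × Fin M₂} (hvw : v ≠ w)
    (hg : v.1 = w.1) :
    ∑ k : CloudKey q n M₁ M₂, cloudProb ω k *
      (if k.2 v = k.2 w ∧ m ≤ hammingDist (k.1 v.1) (k.2 v) then 1 else 0) ≤
      (1 - ω) ^ n * (ω / ((q - 1) * (1 - ω))) ^ m := by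
  have hq2 : (2 : ℝ) ≤ q := by exact_mod_cast hq
  have hψ0 : 0 < ω / ((q - 1) * (1 - ω)) :=
    div_pos h0 (mul_pos (by linarith) (by linarith))
  have hn : (0 : ℝ) ≤ (1 - ω) ^ n := pow_nonneg (by linarith) _
  rw [sum_cloudProb_mul_pair hq ω hvw
    (fun σ a b => if a = b ∧ m ≤ hammingDist (σ v.1) a then 1 else 0)]
  refine sum_centre_weight_mul_le hq _ _ fun σ => ?_
  refine le_trans ?_ (sum_symChannelPi_mul hq ω (σ v.1) _).le
  refine Finset.sum_le_sum fun a _ =>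
    mul_le_mul_of_nonneg_left ?_ (symChannelPi_nonneg hq h0.le h1.le _ _)
  by_cases ha : m ≤ hammingDist (σ v.1) a
  · simp only [ha, and_true, mul_ite, mul_one, mul_zero, Finset.sum_ite_eq, Finset.mem_univ,
      if_true]
    rw [← hg, symChannelPi_eq hq h1]
    refine mul_le_mul_of_nonneg_left ?_ hn
    rw [← Real.rpow_natCast]
    exact Real.rpow_le_rpow_of_exponent_ge hψ0 hψ ha
  · simp only [ha, and_false, if_false, mul_zero, Finset.sum_const_zero]
    positivity

theorem sum_cloudProb_collision_of_ne_group (hq : 2 ≤ q) (ω : ℝ) {v w : Fin M₁ × Fin M₂}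
    (hg : v.1 ≠ w.1) :
    ∑ k : CloudKey q n M₁ M₂, cloudProb ω k * (if k.2 v = k.2 w then 1 else 0) =
      ((q : ℝ) ^ n)⁻¹ := by
  have hvw : v ≠ w := fun h => hg (congrArg Prod.fst h)
  rw [sum_cloudProb_mul_pair hq ω hvw (fun σ a b => if a = b then 1 else 0)]
  simp only [mul_ite, mul_one, mul_zero, Finset.sum_ite_eq, Finset.mem_univ, if_true]
  rw [← sum_cloudProb_mul_single (M₂ := M₂) hq ω v (fun σ a => symChannelPi q n ω (σ w.1) a)]
  refine (sum_cloudProb_mul_resample hq ω (fun _ : Unit => v) (fun _ _ _ => rfl) w.1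
    (fun _ => hg) (fun X c => symChannelPi q n ω c (X ()))).trans ?_
  have hcol : ∀ d : Fin n → Fin q, ∑ c, symChannelPi q n ω c d = 1 := fun d =>
    (Finset.sum_congr rfl fun c _ => symChannelPi_comm ω c d).trans (sum_symChannelPi hq ω d)
  simp_rw [hcol, mul_one]
  rw [← Finset.sum_mul, sum_cloudProb hq, one_mul]

end Collisions

theorem exists_far_bound {q : ℕ} (hq : 2 ≤ q) (ω η : ℝ) (h0 : 0 ≤ ω) (h1 : ω ≤ 1)
    (hη : 0 < η) :
    ∃ ρ : ℝ, 0 ≤ ρ ∧ ρ < 1 ∧ ∀ (n : ℕ) {M₁ M₂ : ℕ} (v : Fin M₁ × Fin M₂),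
      ∑ k : CloudKey q n M₁ M₂, cloudProb ω k *
        (if (n : ℝ) * (ω + η) < hammingDist (k.1 v.1) (k.2 v) then 1 else 0) ≤ ρ ^ n := by
  obtain ⟨ρ, hρ0, hρ1, H⟩ := exists_chernoff ω η h0 h1 hη
  refine ⟨ρ, hρ0, hρ1, fun n M₁ M₂ v => ?_⟩
  rw [sum_cloudProb_mul_single hq ω v
    (fun σ a => if (n : ℝ) * (ω + η) < hammingDist (σ v.1) a then 1 else 0)]
  refine sum_centre_weight_mul_le hq _ _ fun σ => ?_
  refine H n (fun l b => symChannel q ω (σ v.1 l) b) (fun l b => σ v.1 l ≠ b)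
    (fun l b => symChannel_nonneg hq h0 h1 _ _) (fun l => sum_symChannel hq ω _) fun l => ?_
  have e : ∀ b, (if σ v.1 l ≠ b then symChannel q ω (σ v.1 l) b else 0) =
      symChannel q ω (σ v.1 l) b -
        (if σ v.1 l = b then symChannel q ω (σ v.1 l) b else 0) := by
    intro b; by_cases h : σ v.1 l = b <;> simp [h]
  simp_rw [e]
  rw [Finset.sum_sub_distrib, sum_symChannel hq, sum_symChannel_eq]
  linarith

theorem exists_close_bound {q : ℕ} (hq : 2 ≤ q) (ω η : ℝ) (h0 : 0 ≤ ω) (h1 : ω ≤ 1)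
    (hη : 0 < η) :
    ∃ ρ : ℝ, 0 ≤ ρ ∧ ρ < 1 ∧ ∀ (n : ℕ) {M₁ M₂ : ℕ} (v : Fin M₁ × Fin M₂),
      ∑ k : CloudKey q n M₁ M₂, cloudProb ω k *
        (if (hammingDist (k.1 v.1) (k.2 v) : ℝ) < n * (ω - η) then 1 else 0) ≤ ρ ^ n := by
  obtain ⟨ρ, hρ0, hρ1, H⟩ := exists_chernoff (1 - ω) η (by linarith) (by linarith) hη
  refine ⟨ρ, hρ0, hρ1, fun n M₁ M₂ v => ?_⟩
  rw [sum_cloudProb_mul_single hq ω v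
    (fun σ a => if (hammingDist (σ v.1) a : ℝ) < n * (ω - η) then 1 else 0)]
  refine sum_centre_weight_mul_le hq _ _ fun σ => ?_
  refine le_trans (le_of_eq (Finset.sum_congr rfl fun a _ => ?_))
    (H n (fun l b => symChannel q ω (σ v.1 l) b) (fun l b => σ v.1 l = b)
    (fun l b => symChannel_nonneg hq h0 h1 _ _) (fun l => sum_symChannel hq ω _)
    fun l => (sum_symChannel_eq ω _).le)
  have e := Finset.card_filter_add_card_filter_not (s := Finset.univ) (fun l => σ v.1 l = a l)
  rw [Finset.card_univ, Fintype.card_fin] at e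
  have e' : ((Finset.univ.filter fun l => σ v.1 l = a l).card : ℝ) +
      hammingDist (σ v.1) a = n := by exact_mod_cast e
  refine congrArg _ (if_congr ?_ rfl rfl)
  constructor <;> intro h <;> linarith

/-- Bound on the probability that the user decoder fails on a single pirate. -/
theorem exists_e2_bound {q : ℕ} (hq : 2 ≤ q) (ω η : ℝ) (h0 : 0 < ω) (h1 : ω < 1)
    (hψ : ω / ((q - 1) * (1 - ω)) ≤ 1) (hη : 0 < η) :
    ∃ ρ : ℝ, 0 ≤ ρ ∧ ρ < 1 ∧ ∀ (n M₁ M₂ : ℕ) (r : ℝ) (u : Fin 1 → Fin M₁ × Fin M₂)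
      (V : (Fin 1 → Fin n → Fin q) → (Fin n → Fin q) → ℝ), Admissible V →
      e2 (cloudRandCode n M₁ M₂ hq ω r h0.le h1.le) u V ≤ ρ ^ n +
        (M₂ * ((1 - ω) ^ n * (ω / ((q - 1) * (1 - ω))) ^ (n * (ω - η))) +
          M₁ * M₂ * ((q : ℝ) ^ n)⁻¹) := by
  obtain ⟨ρ, hρ0, hρ1, H⟩ := exists_close_bound hq ω η h0.le h1.le hη
  refine ⟨ρ, hρ0, hρ1, fun n M₁ M₂ r u V hV => ?_⟩
  have hq2 : (2 : ℝ) ≤ q := by exact_mod_cast hq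
  obtain ⟨hV0, hV1, hVE⟩ := hV
  classical
  rw [e2_cloudRandCode]
  set v := u 0 with hv
  set others := Finset.univ.filter fun w : Fin M₁ × Fin M₂ => w ≠ v with hothers
  let f₁ : CloudKey q n M₁ M₂ → ℝ := fun k =>
    if (hammingDist (k.1 v.1) (k.2 v) : ℝ) < n * (ω - η) then 1 else 0
  let f₂ : Fin M₁ × Fin M₂ → CloudKey q n M₁ M₂ → ℝ := fun w k =>
    if k.2 v = k.2 w ∧ (n : ℝ) * (ω - η) ≤ hammingDist (k.1 v.1) (k.2 v) then 1 else 0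
  have hf₂ : ∀ w k, 0 ≤ f₂ w k := fun w k => by simp only [f₂]; split_ifs <;> norm_num
  have hpoint : ∀ k : CloudKey q n M₁ M₂,
      ∑ y ∈ Finset.univ.filter
        (fun y : Fin n → Fin q => ¬ ∃ i, (cloudCode r k).dec2 y = some (u i)),
        V (k.2 ∘ u) y ≤ f₁ k + ∑ w ∈ others, f₂ w k := by
    intro k
    have hle1 : ∑ y ∈ Finset.univ.filter
        (fun y : Fin n → Fin q => ¬ ∃ i, (cloudCode r k).dec2 y = some (u i)),
        V (k.2 ∘ u) y ≤ 1 := by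
      rw [← hV1 (k.2 ∘ u)]
      exact Finset.sum_le_sum_of_subset_of_nonneg (Finset.filter_subset _ _)
        fun y _ _ => hV0 _ _
    by_cases hc : (hammingDist (k.1 v.1) (k.2 v) : ℝ) < n * (ω - η)
    · have : f₁ k = 1 := if_pos hc
      have := Finset.sum_nonneg fun w (_ : w ∈ others) => hf₂ w k
      linarith
    · have hf₁ : f₁ k = 0 := if_neg hc
      rw [hf₁, zero_add]
      by_cases hcol : ∃ w, w ≠ v ∧ k.2 w = k.2 v
      · obtain ⟨w, hw, hwv⟩ := hcol
        refine hle1.trans ?_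
        have : f₂ w k = 1 := if_pos ⟨hwv.symm, not_lt.mp hc⟩
        rw [← this]
        exact Finset.single_le_sum (fun w _ => hf₂ w k) (by simp [hothers, hw])
      · refine le_trans (le_of_eq (Finset.sum_eq_zero fun y hy => ?_))
          (Finset.sum_nonneg fun w _ => hf₂ w k)
        apply hVE
        intro hE
        refine (Finset.mem_filter.mp hy).2 ⟨0, ?_⟩
        have hy' : k.2 v = y := by
          funext l
          obtain ⟨i, hi⟩ := hE l
          rw [hi, Subsingleton.elim i 0]
          rfl
        have hex : ∃ w, k.2 w = y := ⟨v, hy'⟩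
        simp only [cloudCode, dif_pos hex, Option.some.injEq]
        by_contra hne
        exact hcol ⟨_, hne, hex.choose_spec.trans hy'.symm⟩
  set β := (1 - ω) ^ n * (ω / ((q - 1) * (1 - ω))) ^ ((n : ℝ) * (ω - η)) with hβ
  have hβ0 : 0 ≤ β := by
    have : 0 < ω / ((q - 1) * (1 - ω)) := div_pos h0 (mul_pos (by linarith) (by linarith))
    have : 0 < 1 - ω := by linarith
    positivity
  have hpair : ∀ w ∈ others, ∑ k, cloudProb ω k * f₂ w k ≤
      (if v.1 = w.1 then β else 0) + ((q : ℝ) ^ n)⁻¹ := by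
    intro w hw
    have hw' : w ≠ v := (Finset.mem_filter.mp hw).2
    have hqn : (0 : ℝ) ≤ ((q : ℝ) ^ n)⁻¹ := by positivity
    split_ifs with hg
    · have := sum_cloudProb_collision_same_group (n := n) hq h0 h1 hψ (n * (ω - η)) hw'.symm hg
      linarith
    · rw [zero_add, ← sum_cloudProb_collision_of_ne_group (n := n) hq ω hg]
      refine Finset.sum_le_sum fun k _ =>
        mul_le_mul_of_nonneg_left ?_ (cloudProb_nonneg hq h0.le h1.le k)
      simp only [f₂]
      split_ifs with ha hb
      · exact le_rfl
      · exact (hb ha.1).elim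
      · norm_num
      · exact le_rfl
  calc _ ≤ ∑ k, cloudProb ω k * (f₁ k + ∑ w ∈ others, f₂ w k) :=
        Finset.sum_le_sum fun k _ =>
          mul_le_mul_of_nonneg_left (hpoint k) (cloudProb_nonneg hq h0.le h1.le k)
    _ = ∑ k, cloudProb ω k * f₁ k + ∑ w ∈ others, ∑ k, cloudProb ω k * f₂ w k := by
        rw [Finset.sum_comm, ← Finset.sum_add_distrib]
        simp_rw [mul_add, Finset.mul_sum]
    _ ≤ ρ ^ n + ∑ w ∈ others, ((if v.1 = w.1 then β else 0) + ((q : ℝ) ^ n)⁻¹) :=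
        add_le_add (H n v) (Finset.sum_le_sum hpair)
    _ ≤ ρ ^ n + ∑ w : Fin M₁ × Fin M₂, ((if v.1 = w.1 then β else 0) + ((q : ℝ) ^ n)⁻¹) := by
        refine add_le_add le_rfl (Finset.sum_le_sum_of_subset_of_nonneg
          (Finset.filter_subset _ _) fun w _ _ => ?_)
        have : (0 : ℝ) ≤ ((q : ℝ) ^ n)⁻¹ := by positivity
        split_ifs <;> linarith
    _ = _ := by
        rw [Finset.sum_add_distrib, Fintype.sum_prod_type, Finset.sum_comm]
        simp [mul_comm]

/-- Bound on the probability that the group decoder fails on a coalition of at most `t`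
pirates. -/
theorem exists_e1_bound (t : ℕ) {q : ℕ} (hq : 2 ≤ q) (ω η τ φ : ℝ) (h0 : 0 ≤ ω) (h1 : ω ≤ 1)
    (hη : 0 < η) (hτ : τ = ((t : ℝ) - 1) / t * (1 - 1 / (q : ℝ) ^ (t - 1)) + ω)
    (hφ0 : 0 < φ) (hφ1 : φ ≤ 1) :
    ∃ ρ ρ' : ℝ, 0 ≤ ρ ∧ ρ < 1 ∧ 0 ≤ ρ' ∧ ρ' < 1 ∧ ∀ (n M₁ M₂ s : ℕ), 0 < s → s ≤ t →
      ∀ (u : Fin s → Fin M₁ × Fin M₂), Function.Injective u →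
      ∀ (V : (Fin s → Fin n → Fin q) → (Fin n → Fin q) → ℝ), Admissible V →
      e1 (cloudRandCode n M₁ M₂ hq ω (n * (τ + 2 * η)) h0 h1) u V ≤ ρ ^ n + (t * ρ' ^ n +
        M₁ * (((1 + (q - 1) * φ) / q) ^ n * φ ^ (-((n : ℝ) * (τ + 2 * η))))) := by
  obtain ⟨ρ, hρ0, hρ1, H⟩ := exists_numMixed_bound t q hq ω η h0 h1 hη
  obtain ⟨ρ', hρ'0, hρ'1, H'⟩ := exists_far_bound hq ω η h0 h1 hη
  refine ⟨ρ, ρ', hρ0, hρ1, hρ'0, hρ'1, fun n M₁ M₂ s hs hst u hu V hV => ?_⟩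
  obtain ⟨hV0, hV1, hVE⟩ := hV
  have ht0 : (0 : ℝ) < t := by exact_mod_cast hs.trans_le hst
  have ht1 : (1 : ℝ) ≤ t := by exact_mod_cast hs.trans_le hst
  classical
  rw [e1_cloudRandCode]
  set r : ℝ := n * (τ + 2 * η) with hr
  set others := Finset.univ.filter fun g : Fin M₁ => ∀ i, (u i).1 ≠ g with hothers
  let f₁ : (Fin s → Fin n → Fin q) → ℝ := fun X =>
    if (n : ℝ) * (1 - 1 / (q : ℝ) ^ (t - 1) + η) < numMixed X then 1 else 0
  let f₂ : Fin s → CloudKey q n M₁ M₂ → ℝ := fun i k =>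
    if (n : ℝ) * (ω + η) < hammingDist (k.1 (u i).1) (k.2 (u i)) then 1 else 0
  let f₃ : (Fin s → Fin n → Fin q) → (Fin n → Fin q) → ℝ := fun X a =>
    ∑ y, V X y * (if (hammingDist y a : ℝ) ≤ r then 1 else 0)
  have hf₁ : ∀ X, 0 ≤ f₁ X := fun X => by simp only [f₁]; split_ifs <;> norm_num
  have hf₂ : ∀ i k, 0 ≤ f₂ i k := fun i k => by simp only [f₂]; split_ifs <;> norm_num
  have hterm : ∀ X y a, 0 ≤ V X y * (if (hammingDist y a : ℝ) ≤ r then 1 else 0) :=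
    fun X y a => mul_nonneg (hV0 _ _) (by split_ifs <;> norm_num)
  have hf₃ : ∀ X a, 0 ≤ f₃ X a := fun X a => Finset.sum_nonneg fun y _ => hterm _ _ _
  have hpoint : ∀ k : CloudKey q n M₁ M₂,
      ∑ y ∈ Finset.univ.filter
        (fun y : Fin n → Fin q => ¬ ∃ i, (cloudCode r k).dec1 y = some (u i).1),
        V (k.2 ∘ u) y ≤
      f₁ (k.2 ∘ u) + (∑ i, f₂ i k + ∑ g ∈ others, f₃ (k.2 ∘ u) (k.1 g)) := by
    intro k
    have hle1 : ∑ y ∈ Finset.univ.filter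
        (fun y : Fin n → Fin q => ¬ ∃ i, (cloudCode r k).dec1 y = some (u i).1),
        V (k.2 ∘ u) y ≤ 1 := by
      rw [← hV1 (k.2 ∘ u)]
      exact Finset.sum_le_sum_of_subset_of_nonneg (Finset.filter_subset _ _)
        fun y _ _ => hV0 _ _
    have hs₂ : 0 ≤ ∑ i, f₂ i k := Finset.sum_nonneg fun i _ => hf₂ i k
    have hs₃ : 0 ≤ ∑ g ∈ others, f₃ (k.2 ∘ u) (k.1 g) :=
      Finset.sum_nonneg fun g _ => hf₃ _ _
    by_cases hc₁ : (n : ℝ) * (1 - 1 / (q : ℝ) ^ (t - 1) + η) < numMixed (k.2 ∘ u)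
    · have : f₁ (k.2 ∘ u) = 1 := if_pos hc₁
      linarith
    by_cases hc₂ : ∃ i, (n : ℝ) * (ω + η) < hammingDist (k.1 (u i).1) (k.2 (u i))
    · obtain ⟨i, hi⟩ := hc₂
      have h2 : f₂ i k = 1 := if_pos hi
      have h3 := Finset.single_le_sum (fun i _ => hf₂ i k) (Finset.mem_univ i)
      have := hf₁ (k.2 ∘ u)
      linarith
    push Not at hc₁ hc₂
    suffices h : ∑ y ∈ Finset.univ.filter
        (fun y : Fin n → Fin q => ¬ ∃ i, (cloudCode r k).dec1 y = some (u i).1),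
        V (k.2 ∘ u) y ≤ ∑ g ∈ others, f₃ (k.2 ∘ u) (k.1 g) by
      have := hf₁ (k.2 ∘ u)
      linarith
    simp only [f₃]
    rw [Finset.sum_comm]
    refine le_trans (Finset.sum_le_sum fun y hy => ?_)
      (Finset.sum_le_sum_of_subset_of_nonneg (Finset.filter_subset _ _)
        fun y _ _ => Finset.sum_nonneg fun g _ => hterm _ _ _)
    by_cases hE : InEnvelope (k.2 ∘ u) y
    · obtain ⟨i, hi⟩ := hammingDist_le_of_inEnvelope hs hst hE
      have hclose : (hammingDist y (k.1 (u i).1) : ℝ) ≤ r := by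
        have htri : (hammingDist y (k.1 (u i).1) : ℝ) ≤
            hammingDist y (k.2 (u i)) + hammingDist (k.1 (u i).1) (k.2 (u i)) := by
          rw [hammingDist_comm (k.1 (u i).1)]
          exact_mod_cast hammingDist_triangle _ _ _
        have hd : 0 ≤ ((t : ℝ) - 1) / t := div_nonneg (by linarith) ht0.le
        have hd1 : ((t : ℝ) - 1) / t ≤ 1 := by rw [div_le_one ht0]; linarith
        have h4 := mul_le_mul_of_nonneg_left hc₁ hd
        have h5 : ((t : ℝ) - 1) / t * (n * η) ≤ n * η :=
          mul_le_of_le_one_left (by positivity) hd1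
        have h6 := hc₂ i
        simp only [Function.comp_apply] at hi
        rw [hr, hτ]
        linarith
      have hex : ∃ g, (hammingDist y (k.1 g) : ℝ) ≤ r := ⟨_, hclose⟩
      have hbad := (Finset.mem_filter.mp hy).2
      simp only [cloudCode, dif_pos hex, Option.some.injEq] at hbad
      push Not at hbad
      have hmem : hex.choose ∈ others :=
        Finset.mem_filter.mpr ⟨Finset.mem_univ _, fun i => (hbad i).symm⟩
      refine le_trans (le_of_eq ?_) (Finset.single_le_sum
        (f := fun g => V (k.2 ∘ u) y * (if (hammingDist y (k.1 g) : ℝ) ≤ r then 1 else 0))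
        (fun g _ => hterm _ _ _) hmem)
      rw [if_pos hex.choose_spec, mul_one]
    · rw [hVE _ _ hE]
      simp
  have hb₁ : ∑ k : CloudKey q n M₁ M₂, cloudProb ω k * f₁ (k.2 ∘ u) ≤ ρ ^ n := by
    rw [sum_cloudProb_mul hq ω u hu (fun _ X => f₁ X)]
    have := H n s (fun i => (u i).1) hs hst
    rwa [Fintype.card_fin] at this
  set γ := ((1 + (q - 1) * φ) / q) ^ n * φ ^ (-r) with hγ
  have hγ0 : 0 ≤ γ := by
    have : (2 : ℝ) ≤ q := by exact_mod_cast hq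
    have : 0 ≤ (q : ℝ) - 1 := by linarith
    positivity
  have hb₃ : ∀ g ∈ others,
      ∑ k : CloudKey q n M₁ M₂, cloudProb ω k * f₃ (k.2 ∘ u) (k.1 g) ≤ γ := by
    intro g hg
    rw [sum_cloudProb_mul_resample hq ω u hu g (Finset.mem_filter.mp hg).2]
    refine sum_cloudProb_mul_le hq h0 h1 _ _ fun k => ?_
    simp only [f₃]
    have hγV : ∑ y, V (k.2 ∘ u) y * γ = γ := by rw [← Finset.sum_mul, hV1, one_mul]
    rw [Finset.sum_comm, Finset.mul_sum]
    refine le_trans ?_ hγV.le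
    refine Finset.sum_le_sum fun y _ => ?_
    rw [← Finset.mul_sum, mul_left_comm]
    exact mul_le_mul_of_nonneg_left (hamming_ball_bound hq φ r hφ0 hφ1 y) (hV0 _ _)
  calc _ ≤ ∑ k : CloudKey q n M₁ M₂, cloudProb ω k *
          (f₁ (k.2 ∘ u) + (∑ i, f₂ i k + ∑ g ∈ others, f₃ (k.2 ∘ u) (k.1 g))) :=
        Finset.sum_le_sum fun k _ =>
          mul_le_mul_of_nonneg_left (hpoint k) (cloudProb_nonneg hq h0 h1 k)
    _ = ∑ k : CloudKey q n M₁ M₂, cloudProb ω k * f₁ (k.2 ∘ u) +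
          (∑ i, ∑ k, cloudProb ω k * f₂ i k +
            ∑ g ∈ others, ∑ k : CloudKey q n M₁ M₂,
              cloudProb ω k * f₃ (k.2 ∘ u) (k.1 g)) := by
        rw [Finset.sum_comm, Finset.sum_comm (s := others), ← Finset.sum_add_distrib,
          ← Finset.sum_add_distrib]
        simp_rw [mul_add, Finset.mul_sum]
    _ ≤ ρ ^ n + (∑ _i : Fin s, ρ' ^ n + ∑ _g ∈ others, γ) :=
        add_le_add hb₁ (add_le_add (Finset.sum_le_sum fun i _ => H' n (u i))
          (Finset.sum_le_sum hb₃))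
    _ ≤ _ := by
        simp only [Finset.sum_const, nsmul_eq_mul, Finset.card_univ, Fintype.card_fin]
        have hcard : (others.card : ℝ) ≤ M₁ := by
          exact_mod_cast (Finset.card_le_univ others).trans_eq (Fintype.card_fin _)
        have hst' : (s : ℝ) ≤ t := by exact_mod_cast hst
        gcongr

theorem rpow_qEntropy {q : ℕ} (hq : 2 ≤ q) {x : ℝ} (h0 : 0 < x) (h1 : x < 1) :
    (q : ℝ) ^ qEntropy q x * ((1 - x) * (x / ((q - 1) * (1 - x))) ^ x) = 1 := by
  have hq2 : (2 : ℝ) ≤ q := by exact_mod_cast hq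
  have hq0 : (0 : ℝ) < q := by linarith
  have hq1 : (q : ℝ) ≠ 1 := by linarith
  have hx : 0 < 1 - x := by linarith
  have hq' : 0 < (q : ℝ) - 1 := by linarith
  have hy : 0 < x / ((q : ℝ) - 1) := div_pos h0 hq'
  have e1 : (q : ℝ) ^ qEntropy q x = (x / (q - 1)) ^ (-x) * (1 - x) ^ (-(1 - x)) := by
    have : qEntropy q x = Real.logb q (x / ((q : ℝ) - 1)) * (-x) +
        Real.logb q (1 - x) * (-(1 - x)) := by unfold qEntropy; ring
    rw [this, Real.rpow_add hq0, Real.rpow_mul hq0.le, Real.rpow_mul hq0.le,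
      Real.rpow_logb hq0 hq1 hy, Real.rpow_logb hq0 hq1 hx]
  have e2 : x / ((q - 1) * (1 - x)) = x / ((q : ℝ) - 1) * (1 - x)⁻¹ := by
    field_simp
  rw [e1, e2, Real.mul_rpow hy.le (by positivity), Real.inv_rpow hx.le, Real.rpow_neg hy.le,
    neg_sub, Real.rpow_sub hx, Real.rpow_one]
  have := Real.rpow_pos_of_pos hy x
  have := Real.rpow_pos_of_pos hx x
  field_simp

theorem qEntropy_eq_qaryEntropy {q : ℕ} (hq : 2 ≤ q) (x : ℝ) (h0 : 0 < x) :
    qEntropy q x = Real.qaryEntropy q x / Real.log q := by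
  have hq2 : (2 : ℝ) ≤ q := by exact_mod_cast hq
  have hq' : (q : ℝ) - 1 ≠ 0 := by linarith
  have hl : Real.log q ≠ 0 := (Real.log_pos (by linarith)).ne'
  rw [qEntropy, Real.logb, Real.logb, Real.log_div h0.ne' hq', Real.qaryEntropy,
    Real.binEntropy_eq_negMulLog_add_negMulLog_one_sub]
  simp only [Real.negMulLog]
  push_cast
  field_simp
  ring

theorem qEntropy_mono {q : ℕ} (hq : 2 ≤ q) {x y : ℝ} (h0 : 0 < x) (hxy : x ≤ y)
    (hy : y ≤ 1 - 1 / (q : ℝ)) : qEntropy q x ≤ qEntropy q y := by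
  have hq2 : (2 : ℝ) ≤ q := by exact_mod_cast hq
  rw [qEntropy_eq_qaryEntropy hq x h0, qEntropy_eq_qaryEntropy hq y (by linarith)]
  refine div_le_div_of_nonneg_right ?_ (Real.log_nonneg (by linarith))
  exact (Real.qaryEntropy_strictMonoOn hq).monotoneOn ⟨h0.le, hxy.trans hy⟩
    ⟨h0.le.trans hxy, hy⟩ hxy

theorem symChannel_ratio_le_one {q : ℕ} (hq : 2 ≤ q) {x : ℝ} (hx : x ≤ 1 - 1 / (q : ℝ)) :
    x / ((q - 1) * (1 - x)) ≤ 1 := by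
  have hq2 : (2 : ℝ) ≤ q := by exact_mod_cast hq
  have hq0 : (0 : ℝ) < q := by linarith
  have hinv : 0 < 1 / (q : ℝ) := by positivity
  have h1 : 0 < 1 - x := by linarith
  have h2 : x * q ≤ q - 1 := by
    have := mul_le_mul_of_nonneg_right hx hq0.le
    rwa [sub_mul, one_mul, one_div_mul_cancel hq0.ne'] at this
  rw [div_le_one (mul_pos (by linarith) h1)]
  linarith

theorem eventually_mul_rpow_lt_one {c ψ : ℝ} (hc : c < 1) (hψ : 0 < ψ) (a : ℝ) :
    ∀ᶠ η in nhdsWithin (0 : ℝ) (Set.Ioi 0), c * ψ ^ (-(a * η)) < 1 := by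
  have hcont : Continuous fun η : ℝ => c * ψ ^ (-(a * η)) :=
    continuous_const.mul (Real.continuous_const_rpow hψ.ne' |>.comp (by fun_prop))
  have := hcont.tendsto 0
  simp only [mul_zero, neg_zero, Real.rpow_zero, mul_one] at this
  exact (this.mono_left nhdsWithin_le_nhds).eventually (gt_mem_nhds hc)

theorem natFloor_rpow_le {q : ℕ} (n : ℕ) (R : ℝ) :
    (⌊(q : ℝ) ^ ((n : ℝ) * R)⌋₊ : ℝ) ≤ ((q : ℝ) ^ R) ^ n := by
  refine (Nat.floor_le (by positivity)).trans (le_of_eq ?_)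
  rw [mul_comm, Real.rpow_mul (by positivity), Real.rpow_natCast]

/-- Theorem 2 of the paper: if `ω ≥ 0` satisfies
`(t−1)/t·(1 − 1/q^{t−1}) + ω ≤ (q−1)/q`, `R₁ < 1 − h((t−1)/t·(1 − 1/q^{t−1}) + ω)`
and `R₂ < h(ω)`, then `(R₁,R₂)` is achievable for `q`-ary `(t,1)`-fingerprinting:
for every `ε > 0` and all large enough `n`, there is an
`(n, ⌊q^{nR₁}⌋, ⌊q^{nR₂}⌋)_q` randomized code that is `(t,1)`-fingerprinting with
`ε`-error. -/
theorem stmt15 (t q : ℕ) (ht : 2 ≤ t) (hq : 2 ≤ q)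
    (R₁ R₂ : ℝ) (hR₁ : 0 ≤ R₁) (hR₂ : 0 ≤ R₂)
    (ω : ℝ) (hω0 : 0 ≤ ω)
    (hωb : ((t : ℝ) - 1) / t * (1 - 1 / (q : ℝ) ^ (t - 1)) + ω ≤ ((q : ℝ) - 1) / q)
    (h1 : R₁ < 1 - qEntropy q (((t : ℝ) - 1) / t * (1 - 1 / (q : ℝ) ^ (t - 1)) + ω))
    (h2 : R₂ < qEntropy q ω) :
    ∀ ε : ℝ, 0 < ε → ∃ n₀ : ℕ, ∀ n : ℕ, n₀ ≤ n →
      ∃ 𝒞 : RandCode q n ⌊(q : ℝ) ^ ((n : ℝ) * R₁)⌋₊ ⌊(q : ℝ) ^ ((n : ℝ) * R₂)⌋₊,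
        IsFingerprinting 𝒞 t 1 ε := by
  have hq2 : (2 : ℝ) ≤ q := by exact_mod_cast hq
  have hq0 : (0 : ℝ) < q := by linarith
  have hq1 : (1 : ℝ) < q := by linarith
  have ht2 : (2 : ℝ) ≤ t := by exact_mod_cast ht
  have hωpos : 0 < ω := by
    rcases hω0.eq_or_lt with h | h
    · rw [← h] at h2
      simp [qEntropy] at h2
      linarith
    · exact h
  have hδ : 0 ≤ ((t : ℝ) - 1) / t * (1 - 1 / (q : ℝ) ^ (t - 1)) := by
    refine mul_nonneg (div_nonneg (by linarith) (by linarith)) ?_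
    rw [sub_nonneg]
    exact (div_le_one (by positivity)).mpr (one_le_pow₀ hq1.le)
  obtain ⟨τ, hτ⟩ : ∃ τ, τ = ((t : ℝ) - 1) / t * (1 - 1 / (q : ℝ) ^ (t - 1)) + ω := ⟨_, rfl⟩
  rw [← hτ] at hωb h1
  have hτq : τ ≤ 1 - 1 / (q : ℝ) := by
    rwa [sub_div, div_self hq0.ne'] at hωb
  have hωτ : ω ≤ τ := by linarith
  have hinv : 0 < 1 / (q : ℝ) := by positivity
  have hτ1 : τ < 1 := by linarith
  have hω1 : ω < 1 := by linarith
  have hmono := qEntropy_mono hq hωpos hωτ hτq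
  set ψ := ω / (((q : ℝ) - 1) * (1 - ω)) with hψ
  have hψ0 : 0 < ψ := div_pos hωpos (mul_pos (by linarith) (by linarith))
  have hψ1 : ψ ≤ 1 := symChannel_ratio_le_one hq (hωτ.trans hτq)
  set φ := τ / (((q : ℝ) - 1) * (1 - τ)) with hφ
  have hφ0 : 0 < φ := div_pos (by linarith) (mul_pos (by linarith) (by linarith))
  have hφ1 : φ ≤ 1 := symChannel_ratio_le_one hq hτq
  have hA : (q : ℝ) ^ R₂ * ((1 - ω) * ψ ^ ω) < 1 := by
    refine lt_of_lt_of_eq ?_ (rpow_qEntropy hq hωpos hω1)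
    refine mul_lt_mul_of_pos_right (Real.rpow_lt_rpow_of_exponent_lt hq1 h2) ?_
    exact mul_pos (by linarith) (Real.rpow_pos_of_pos hψ0 _)
  have hφsum : (1 + ((q : ℝ) - 1) * φ) / q = (q * (1 - τ))⁻¹ := by
    have : (q : ℝ) - 1 ≠ 0 := by linarith
    have : 1 - τ ≠ 0 := by linarith
    rw [hφ]
    field_simp
    ring
  have hB : (q : ℝ) ^ R₁ * ((1 + ((q : ℝ) - 1) * φ) / q * φ ^ (-τ)) < 1 := by
    have e := rpow_qEntropy hq (by linarith : 0 < τ) hτ1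
    have hpos : 0 < (1 - τ) * φ ^ τ := mul_pos (by linarith) (Real.rpow_pos_of_pos hφ0 _)
    have e' : (1 + ((q : ℝ) - 1) * φ) / q * φ ^ (-τ) = (q : ℝ) ^ (qEntropy q τ - 1) := by
      rw [Real.rpow_sub hq0, Real.rpow_one, eq_div_of_mul_eq hpos.ne' e, hφsum,
        Real.rpow_neg hφ0.le, mul_inv, div_div, one_div, mul_inv, mul_inv]
      ring
    rw [e', ← Real.rpow_add hq0]
    exact Real.rpow_lt_one_of_one_lt_of_neg hq1 (by linarith)
  obtain ⟨η, ⟨hηA, hηB⟩, hη⟩ := (((eventually_mul_rpow_lt_one hA hψ0 1).and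
    (eventually_mul_rpow_lt_one hB hφ0 2)).and self_mem_nhdsWithin).exists
  obtain ⟨ρ₁, hρ₁0, hρ₁1, H₂⟩ := exists_e2_bound hq ω η hωpos hω1 hψ1 hη
  obtain ⟨ρ₂, ρ₃, hρ₂0, hρ₂1, hρ₃0, hρ₃1, H₁⟩ :=
    exists_e1_bound t hq ω η τ φ hω0 hω1.le hη hτ hφ0 hφ1
  set A := (q : ℝ) ^ R₂ * ((1 - ω) * ψ ^ ω) * ψ ^ (-(1 * η)) with hAdef
  set B := (q : ℝ) ^ R₁ * ((1 + ((q : ℝ) - 1) * φ) / q * φ ^ (-τ)) * φ ^ (-(2 * η)) with hBdef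
  set C := (q : ℝ) ^ R₁ * (q : ℝ) ^ R₂ * (q : ℝ)⁻¹ with hCdef
  have hA0 : 0 ≤ A := by
    have : 0 < 1 - ω := by linarith
    positivity
  have hB0 : 0 ≤ B := by
    have : 0 < (q : ℝ) - 1 := by linarith
    positivity
  have hC0 : 0 ≤ C := by positivity
  have hC1 : C < 1 := by
    rw [hCdef, ← Real.rpow_add hq0, ← Real.rpow_neg_one, ← Real.rpow_add hq0]
    exact Real.rpow_lt_one_of_one_lt_of_neg hq1 (by linarith)
  intro ε hε
  have hT : ∀ {x : ℝ}, 0 ≤ x → x < 1 → Filter.Tendsto (fun n : ℕ => x ^ n) Filter.atTop (nhds 0) :=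
    fun h h' => tendsto_pow_atTop_nhds_zero_of_lt_one h h'
  have l2 := (hT hρ₁0 hρ₁1).add ((hT hA0 hηA).add (hT hC0 hC1))
  have l1 := (hT hρ₂0 hρ₂1).add (((hT hρ₃0 hρ₃1).const_mul (t : ℝ)).add (hT hB0 hηB))
  simp only [mul_zero, add_zero] at l1 l2
  obtain ⟨n₀, hn₀⟩ := Filter.eventually_atTop.mp
    ((l1.eventually (gt_mem_nhds hε)).and (l2.eventually (gt_mem_nhds hε)))
  refine ⟨n₀, fun n hn => ?_⟩
  obtain ⟨g1, g2⟩ := hn₀ n hn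
  have hM₁ := natFloor_rpow_le (q := q) n R₁
  have hM₂ := natFloor_rpow_le (q := q) n R₂
  refine ⟨cloudRandCode n _ _ hq ω (n * (τ + 2 * η)) hω0 hω1.le, ?_, ?_⟩
  · intro s hs hs1 u _ V hV
    obtain rfl : s = 1 := by omega
    refine (H₂ n _ _ (n * (τ + 2 * η)) u V hV).trans (le_trans ?_ g2.le)
    refine add_le_add le_rfl (add_le_add ?_ ?_)
    · have e : A ^ n = ((q : ℝ) ^ R₂) ^ n * ((1 - ω) ^ n * ψ ^ ((n : ℝ) * (ω - η))) := by
        rw [hAdef, mul_assoc, mul_assoc, ← Real.rpow_add hψ0, mul_pow, mul_pow,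
          ← Real.rpow_natCast (ψ ^ _), ← Real.rpow_mul hψ0.le]
        ring_nf
      rw [e]
      refine mul_le_mul_of_nonneg_right hM₂ ?_
      have : 0 < 1 - ω := by linarith
      positivity
    · rw [hCdef, mul_pow, mul_pow, inv_pow]
      gcongr
  · intro s hs hst u hu V hV
    refine (H₁ n _ _ s hs hst u hu V hV).trans (le_trans ?_ g1.le)
    refine add_le_add le_rfl (add_le_add le_rfl ?_)
    have e : B ^ n = ((q : ℝ) ^ R₁) ^ n *
        (((1 + ((q : ℝ) - 1) * φ) / q) ^ n * φ ^ (-((n : ℝ) * (τ + 2 * η)))) := by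
      rw [hBdef, mul_assoc, mul_assoc, ← Real.rpow_add hφ0, mul_pow, mul_pow,
        ← Real.rpow_natCast (φ ^ _), ← Real.rpow_mul hφ0.le]
      ring_nf
    rw [e]
    refine mul_le_mul_of_nonneg_right hM₁ ?_
    have : 0 < (q : ℝ) - 1 := by linarith
    positivity
end
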